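/- Let x and y be normal and finite-state independent infinite words, and let y′ be an infinite word obtained from y by oblivious selection by a finite automaton. Then x and y′ are finite-state independent. -/

import Mathlib

open Filter Topology

namespace FSI

variable {A B D Q : Type*}

/-- The prefix of length `n` of the infinite word `x`. -/
def pref (x : ℕ → A) (n : ℕ) : List A := (List.range n).map x

/-- Number of (possibly overlapping) occurrences of `u` in `w`. -/
noncomputable def occ (w u : List A) : ℕ :=
  Nat.card {i : ℕ | i + u.length ≤ w.length ∧ (w.drop i).take u.length = u}

/-- Number of aligned occurrences of `u` in `w`. -/
noncomputable def alocc (w u : List A) : ℕ :=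
  Nat.card {i : ℕ | i + u.length ≤ w.length ∧ i % u.length = 0 ∧ (w.drop i).take u.length = u}

/-- `x` is simply normal to word length `ℓ`. -/
def SimplyNormalTo [Fintype A] (x : ℕ → A) (ℓ : ℕ) : Prop :=
  ∀ u : List A, u.length = ℓ →
    Tendsto (fun n : ℕ => (alocc (pref x (n * ℓ)) u : ℝ) / n) atTop
      (nhds ((Fintype.card A : ℝ)⁻¹ ^ ℓ))

/-- `x` is a normal infinite word. -/
def Normal [Fintype A] (x : ℕ → A) : Prop := ∀ ℓ : ℕ, 1 ≤ ℓ → SimplyNormalTo x ℓ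

/-! ### Two-tape automata -/

/-- A `2`-automaton with input alphabets `A`, `B` and state set `Q`;
`none` plays the role of the empty word `ε` in transition labels. -/
structure TwoAut (A B Q : Type*) where
  init : Set Q
  trans : Set (Q × (Option A × Option B) × Q)

/-- The support of a label. -/
def lsupp (l : Option A × Option B) : Bool × Bool := (l.1.isSome, l.2.isSome)

/-- A `2`-deterministic `2`-automaton. -/
def TwoAut.TwoDet (M : TwoAut A B Q) : Prop :=
  (∃ q₀, M.init = {q₀}) ∧
  ∀ t ∈ M.trans, ∀ t' ∈ M.trans, t.1 = t'.1 →
    lsupp t.2.1 = lsupp t'.2.1 ∧ (t.2.1 = t'.2.1 → t = t')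

/-- A `1`-deterministic `2`-automaton. -/
def TwoAut.OneDet (M : TwoAut A B Q) : Prop :=
  (∃ q₀, M.init = {q₀}) ∧
  ∀ t ∈ M.trans, ∀ t' ∈ M.trans, t.1 = t'.1 →
    t.2.1.1.isSome = t'.2.1.1.isSome ∧ (t.2.1.1 = t'.2.1.1 → t = t')

/-- `2`-completeness. -/
def TwoAut.TwoComplete (M : TwoAut A B Q) : Prop :=
  ∀ (q : Q) (l l' : Option A × Option B),
    (∃ q', (q, l, q') ∈ M.trans) → lsupp l' = lsupp l → ∃ q', (q, l', q') ∈ M.trans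

/-- Every transition reads exactly one symbol. -/
def TwoAut.OneSymbol (M : TwoAut A B Q) : Prop :=
  ∀ t ∈ M.trans, lsupp t.2.1 = (true, false) ∨ lsupp t.2.1 = (false, true)

def TwoAut.Step (M : TwoAut A B Q) (p q : Q) : Prop := ∃ l, (p, l, q) ∈ M.trans

/-- There is a finite run from `p` to `q`. -/
def TwoAut.Reaches (M : TwoAut A B Q) : Q → Q → Prop := Relation.ReflTransGen M.Step

def TwoAut.StronglyConnected (M : TwoAut A B Q) : Prop := ∀ p q, M.Reaches p q

/-- Word read on the first tape by the first `n` transitions of `γ`. -/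
def in1 (γ : ℕ → Q × (Option A × Option B) × Q) (n : ℕ) : List A :=
  ((List.range n).map fun i => (γ i).2.1.1).reduceOption

/-- Word read on the second tape by the first `n` transitions of `γ`. -/
def in2 (γ : ℕ → Q × (Option A × Option B) × Q) (n : ℕ) : List B :=
  ((List.range n).map fun i => (γ i).2.1.2).reduceOption

/-- `γ` is an infinite run of `M` (not necessarily from the initial state) whose
two input labels are the infinite words `x` and `y`. -/
def TwoAut.IsRunOn (M : TwoAut A B Q) (γ : ℕ → Q × (Option A × Option B) × Q)
    (x : ℕ → A) (y : ℕ → B) : Prop :=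
  (∀ n, γ n ∈ M.trans) ∧ (∀ n, (γ n).2.2 = (γ (n + 1)).1) ∧
  (∀ n, in1 γ n = pref x (in1 γ n).length) ∧ (∀ n, in2 γ n = pref y (in2 γ n).length) ∧
  Tendsto (fun n => (in1 γ n).length) atTop atTop ∧
  Tendsto (fun n => (in2 γ n).length) atTop atTop

/-- The pair `(x, y)` is accepted by `M`. -/
def TwoAut.Accepts (M : TwoAut A B Q) (x : ℕ → A) (y : ℕ → B) : Prop :=
  ∃ γ, (γ 0).1 ∈ M.init ∧ M.IsRunOn γ x y

/-- Number of occurrences of the state `q` among the first `n` transitions of `γ`. -/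
noncomputable def stateCount (γ : ℕ → Q × (Option A × Option B) × Q) (q : Q) (n : ℕ) : ℕ :=
  Nat.card {i : ℕ | i < n ∧ (γ i).1 = q}

/-- Number of occurrences of the transition `τ` among the first `n` transitions of `γ`. -/
noncomputable def transCount (γ : ℕ → Q × (Option A × Option B) × Q)
    (τ : Q × (Option A × Option B) × Q) (n : ℕ) : ℕ :=
  Nat.card {i : ℕ | i < n ∧ γ i = τ}

/-! ### Markov chain associated with a one-symbol automaton -/

/-- The `(p,q)` entry of the Markov matrix associated with the transition set `T`. -/
noncomputable def markovOf {S : Type*} [Fintype A] [Fintype B]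
    (T : Set (S × (Option A × Option B) × S)) (p q : S) : ℝ :=
  (Nat.card {a : A | (p, (some a, none), q) ∈ T} : ℝ) / (Fintype.card A : ℝ) +
  (Nat.card {b : B | (p, (none, some b), q) ∈ T} : ℝ) / (Fintype.card B : ℝ)

/-- `π` is a stationary distribution for the transition set `T` restricted to the
finite state set `st`. -/
def IsStationaryOn {S : Type*} [Fintype A] [Fintype B]
    (T : Set (S × (Option A × Option B) × S)) (st : Finset S) (π : S → ℝ) : Prop :=
  (∀ s ∈ st, 0 ≤ π s) ∧ (∑ s ∈ st, π s = 1) ∧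
  ∀ q ∈ st, (∑ p ∈ st, π p * markovOf T p q) = π q

/-- `π` is a stationary distribution of the Markov chain associated with `M`. -/
def TwoAut.IsStationary [Fintype A] [Fintype B] [Fintype Q]
    (M : TwoAut A B Q) (π : Q → ℝ) : Prop :=
  IsStationaryOn M.trans Finset.univ π

/-- The frequency property for the pair `(x, y)`: in every strongly connected
`2`-deterministic `2`-automaton (reading one symbol per transition), every infinite run
on a suffix of `x` and a suffix of `y` visits each state with frequency given by the
stationary distribution, and the automaton is `2`-complete. -/
def FreqProp [Fintype A] [Fintype B] (x : ℕ → A) (y : ℕ → B) : Prop :=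
  ∀ (Q' : Type) [Fintype Q'] (M : TwoAut A B Q'), M.TwoDet → M.OneSymbol →
    M.StronglyConnected →
    ∀ (i j : ℕ) (γ : ℕ → Q' × (Option A × Option B) × Q'),
      M.IsRunOn γ (fun n => x (n + i)) (fun n => y (n + j)) →
      M.TwoComplete ∧
      ∃ π : Q' → ℝ, M.IsStationary π ∧
        ∀ q, Tendsto (fun n : ℕ => (stateCount γ q n : ℝ) / n) atTop (nhds (π q))

/-! ### Conditional compressors (2-deterministic 3-automata) -/

/-- A `3`-automaton with two input tapes (alphabets `A` and `B`) and one
output tape (alphabet `D`), with a single initial state. -/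
structure Comp3 (A B D Q : Type*) where
  init : Q
  trans : Set (Q × (Option A × Option B) × List D × Q)

/-- `2`-determinism for `3`-automata. -/
def Comp3.TwoDet (C : Comp3 A B D Q) : Prop :=
  ∀ t ∈ C.trans, ∀ t' ∈ C.trans, t.1 = t'.1 →
    lsupp t.2.1 = lsupp t'.2.1 ∧ (t.2.1 = t'.2.1 → t = t')

def c3in1 (γ : ℕ → Q × (Option A × Option B) × List D × Q) (n : ℕ) : List A :=
  ((List.range n).map fun i => (γ i).2.1.1).reduceOption

def c3in2 (γ : ℕ → Q × (Option A × Option B) × List D × Q) (n : ℕ) : List B :=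
  ((List.range n).map fun i => (γ i).2.1.2).reduceOption

def c3out (γ : ℕ → Q × (Option A × Option B) × List D × Q) (n : ℕ) : List D :=
  ((List.range n).map fun i => (γ i).2.2.1).flatten

/-- `γ` is the accepting run of `C` on the pair `(x, y)`. -/
def Comp3.IsAccRunOn (C : Comp3 A B D Q) (γ : ℕ → Q × (Option A × Option B) × List D × Q)
    (x : ℕ → A) (y : ℕ → B) : Prop :=
  (γ 0).1 = C.init ∧ (∀ n, γ n ∈ C.trans) ∧ (∀ n, (γ n).2.2.2 = (γ (n + 1)).1) ∧
  (∀ n, c3in1 γ n = pref x (c3in1 γ n).length) ∧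
  (∀ n, c3in2 γ n = pref y (c3in2 γ n).length) ∧
  Tendsto (fun n => (c3in1 γ n).length) atTop atTop ∧
  Tendsto (fun n => (c3in2 γ n).length) atTop atTop ∧
  Tendsto (fun n => (c3out γ n).length) atTop atTop

/-- For every fixed second input `y`, the input-output map `x ↦ C(x,y)` is one-to-one. -/
def Comp3.OneToOne (C : Comp3 A B D Q) : Prop :=
  ∀ (x x' : ℕ → A) (y : ℕ → B) γ γ', C.IsAccRunOn γ x y → C.IsAccRunOn γ' x' y →
    (∀ n, ∃ m, c3out γ n <+: c3out γ' m) → (∀ n, ∃ m, c3out γ' n <+: c3out γ m) →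
    x = x'

/-- The conditional compression ratio `ρ(x/y)`: the infimum, over all conditional
compressors, of the compression ratio of `x` given the oracle `y`. -/
noncomputable def condRho [Fintype A] [Fintype B] (x : ℕ → A) (y : ℕ → B) : ℝ :=
  sInf {r : ℝ | ∃ (m d : ℕ), 2 ≤ d ∧ ∃ C : Comp3 A B (Fin d) (Fin m),
    C.TwoDet ∧ C.OneToOne ∧ ∃ γ, C.IsAccRunOn γ x y ∧
      r = Filter.liminf (fun n : ℕ =>
        (((c3out γ n).length : ℝ) * Real.log d) /
        (((c3in1 γ n).length : ℝ) * Real.log (Fintype.card A))) atTop}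

/-! ### Compressors (one-to-one 1-deterministic 2-automata) -/

/-- A `2`-automaton with one input tape (alphabet `A`) and one output tape
(alphabet `D`), with a single initial state. -/
structure Comp2 (A D Q : Type*) where
  init : Q
  trans : Set (Q × Option A × List D × Q)

def Comp2.OneDet (C : Comp2 A D Q) : Prop :=
  ∀ t ∈ C.trans, ∀ t' ∈ C.trans, t.1 = t'.1 →
    t.2.1.isSome = t'.2.1.isSome ∧ (t.2.1 = t'.2.1 → t = t')

def c2in (γ : ℕ → Q × Option A × List D × Q) (n : ℕ) : List A :=
  ((List.range n).map fun i => (γ i).2.1).reduceOption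

def c2out (γ : ℕ → Q × Option A × List D × Q) (n : ℕ) : List D :=
  ((List.range n).map fun i => (γ i).2.2.1).flatten

def Comp2.IsAccRunOn (C : Comp2 A D Q) (γ : ℕ → Q × Option A × List D × Q)
    (x : ℕ → A) : Prop :=
  (γ 0).1 = C.init ∧ (∀ n, γ n ∈ C.trans) ∧ (∀ n, (γ n).2.2.2 = (γ (n + 1)).1) ∧
  (∀ n, c2in γ n = pref x (c2in γ n).length) ∧
  Tendsto (fun n => (c2in γ n).length) atTop atTop ∧
  Tendsto (fun n => (c2out γ n).length) atTop atTop

def Comp2.OneToOne (C : Comp2 A D Q) : Prop :=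
  ∀ (x x' : ℕ → A) γ γ', C.IsAccRunOn γ x → C.IsAccRunOn γ' x' →
    (∀ n, ∃ m, c2out γ n <+: c2out γ' m) → (∀ n, ∃ m, c2out γ' n <+: c2out γ m) →
    x = x'

/-- The compression ratio `ρ(x)`. -/
noncomputable def rho [Fintype A] (x : ℕ → A) : ℝ :=
  sInf {r : ℝ | ∃ (m d : ℕ), 2 ≤ d ∧ ∃ C : Comp2 A (Fin d) (Fin m),
    C.OneDet ∧ C.OneToOne ∧ ∃ γ, C.IsAccRunOn γ x ∧
      r = Filter.liminf (fun n : ℕ =>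
        (((c2out γ n).length : ℝ) * Real.log d) /
        (((c2in γ n).length : ℝ) * Real.log (Fintype.card A))) atTop}

/-- Finite-state independence. -/
def FSIndep [Fintype A] [Fintype B] (x : ℕ → A) (y : ℕ → B) : Prop :=
  condRho x y = rho x ∧ condRho y x = rho y ∧ 0 < rho x ∧ 0 < rho y

/-! ### Oblivious selectors with two input tapes -/

/-- Types of states of a selector. -/
inductive SelTy | I | II | III

/-- An oblivious selector with first input alphabet `A` and second input alphabet `B`:
at a state of type I it reads the next symbol of the first input and selects it, at a
state of type II it reads the next symbol of the first input without selecting it, and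
at a state of type III it reads the next symbol of the second input. -/
structure Sel2 (A B : Type*) where
  states : ℕ
  init : Fin states
  ty : Fin states → SelTy
  δa : Fin states → A → Fin states
  δb : Fin states → B → Fin states

/-- Configuration (current state, symbols read from `x`, symbols read from `y`)
after `n` steps. -/
def Sel2.cfg (S : Sel2 A B) (x : ℕ → A) (y : ℕ → B) : ℕ → Fin S.states × ℕ × ℕ
  | 0 => (S.init, 0, 0)
  | n + 1 =>
    let c := S.cfg x y n
    match S.ty c.1 with
    | SelTy.I => (S.δa c.1 (x c.2.1), c.2.1 + 1, c.2.2)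
    | SelTy.II => (S.δa c.1 (x c.2.1), c.2.1 + 1, c.2.2)
    | SelTy.III => (S.δb c.1 (y c.2.2), c.2.1, c.2.2 + 1)

/-- The word selected from `x` during the first `n` steps. -/
def Sel2.outList (S : Sel2 A B) (x : ℕ → A) (y : ℕ → B) (n : ℕ) : List A :=
  (List.range n).filterMap fun i =>
    let c := S.cfg x y i
    match S.ty c.1 with
    | SelTy.I => some (x c.2.1)
    | SelTy.II => none
    | SelTy.III => none

/-! ### Oblivious one-input selection automata -/

/-- An oblivious selection automaton with a single input tape. -/
structure Sel1 (B : Type*) where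
  states : ℕ
  init : Fin states
  sel : Fin states → Bool
  δ : Fin states → B → Fin states

/-- State after reading the first `n` symbols of `y`. -/
def Sel1.st (S : Sel1 B) (y : ℕ → B) : ℕ → Fin S.states
  | 0 => S.init
  | n + 1 => S.δ (S.st y n) (y n)

/-- The word selected from the first `n` symbols of `y`. -/
def Sel1.outList (S : Sel1 B) (y : ℕ → B) (n : ℕ) : List B :=
  (List.range n).filterMap fun i => if S.sel (S.st y i) then some (y i) else none

/-! ### Shufflers -/

/-- A shuffler over the alphabet `A`: at a state of type I it reads, outputs and moves
on the next symbol of the first input; at a state of type II it does so with the second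
input. -/
structure Shuffler (A : Type*) where
  states : ℕ
  init : Fin states
  tyI : Fin states → Bool
  δ : Fin states → A → Fin states

/-- Configuration (current state, symbols read from `x`, symbols read from `y`)
after `n` steps. -/
def Shuffler.cfg (S : Shuffler A) (x y : ℕ → A) : ℕ → Fin S.states × ℕ × ℕ
  | 0 => (S.init, 0, 0)
  | n + 1 =>
    let c := S.cfg x y n
    if S.tyI c.1 then (S.δ c.1 (x c.2.1), c.2.1 + 1, c.2.2)
    else (S.δ c.1 (y c.2.2), c.2.1, c.2.2 + 1)

/-- The output `S(x,y)` of the shuffler `S` on inputs `x` and `y`. -/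
def Shuffler.out (S : Shuffler A) (x y : ℕ → A) (n : ℕ) : A :=
  let c := S.cfg x y n
  if S.tyI c.1 then x c.2.1 else y c.2.2

/-! ### Look-ahead automata -/

/-- The transitions of the look-ahead automaton `𝒜_{k,ℓ}`. -/
def lookTrans (M : TwoAut A B Q) (k ℓ : ℕ) :
    Set ((Q × List A × List B) × (Option A × Option B) × (Q × List A × List B)) :=
  {t | (∃ (q : Q) (u : List A) (a : A), u.length < k ∧
          t = ((q, u, []), (some a, none), (q, u ++ [a], ([] : List B)))) ∨
       (∃ (q : Q) (u : List A) (v : List B) (b : B), u.length = k ∧ v.length < ℓ ∧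
          t = ((q, u, v), (none, some b), (q, u, v ++ [b]))) ∨
       (∃ (q q' : Q) (a a' : A) (u' : List A) (v : List B),
          u'.length = k - 1 ∧ v.length = ℓ ∧ (q, (some a, none), q') ∈ M.trans ∧
          t = ((q, a :: u', v), (some a', none), (q', u' ++ [a'], v))) ∨
       (∃ (q q' : Q) (b b' : B) (u : List A) (v' : List B),
          u.length = k ∧ v'.length = ℓ - 1 ∧ (q, (none, some b), q') ∈ M.trans ∧
          t = ((q, u, b :: v'), (none, some b'), (q', u, v' ++ [b'])))}

/-- The (finite) set of states of the look-ahead automaton with full buffers,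
i.e. `Q × A^k × B^ℓ`. -/
noncomputable def fullFinset (Q A B : Type*) [Fintype Q] [Fintype A] [Fintype B]
    (k ℓ : ℕ) : Finset (Q × List A × List B) :=
  letI := Classical.decEq (Q × List A × List B)
  (Finset.univ : Finset (Q × (Fin k → A) × (Fin ℓ → B))).image
    fun s => (s.1, List.ofFn s.2.1, List.ofFn s.2.2)

/-! ### Counting words and measures -/

/-- The number of words of length `n` with exactly `i` occurrences of `γ`. -/
noncomputable def Ncount (γ : List A) (i n : ℕ) : ℕ :=
  Nat.card {w : List A // w.length = n ∧ occ w γ = i}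

/-- The cylinder of infinite words starting with `w`. -/
def cylinder (w : List A) : Set (ℕ → A) := {x : ℕ → A | pref x w.length = w}

/-- The set `E_S(ε,γ,n)` of pairs of inputs for which the frequency of `γ` in the first
`n` symbols of `S(x,y)` deviates from `|A|^{-|γ|}` by less than `ε`. -/
def Eset [Fintype A] (S : Shuffler A) (ε : ℝ) (γ : List A) (n : ℕ) :
    Set ((ℕ → A) × (ℕ → A)) :=
  {p : (ℕ → A) × (ℕ → A) |
    |(occ (pref (S.out p.1 p.2) n) γ : ℝ) - (n : ℝ) / (Fintype.card A : ℝ) ^ γ.length|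
      < ε * n}

/-- The set `F(ε,t,ℓ,n)`. -/
def Fset [Fintype A] (S : ℕ → Shuffler A) (ε : ℝ) (t ℓ n : ℕ) :
    Set ((ℕ → A) × (ℕ → A)) :=
  ⋂ i ∈ Finset.Icc 1 t, ⋂ r ∈ Finset.Icc 1 ℓ,
    ⋂ γ ∈ {γ : List A | γ.length = r}, Eset (S i) ε γ n

/-- `ℓ_n = (log_{|A|} n)/3`. -/
noncomputable def ellSeq (A : Type*) [Fintype A] (n : ℕ) : ℝ :=
  Real.logb (Fintype.card A) n / 3

/-- `ε_n = 2 √((log n · log_{|A|} n)/n)`. -/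
noncomputable def epsSeq (A : Type*) [Fintype A] (n : ℕ) : ℝ :=
  2 * Real.sqrt (Real.log n * Real.logb (Fintype.card A) n / n)

/-- `F_n = F(ε_n, t_n, ℓ_n, n)` with `t_n = n`. -/
noncomputable def Fn [Fintype A] (S : ℕ → Shuffler A) (n : ℕ) :
    Set ((ℕ → A) × (ℕ → A)) :=
  Fset S (epsSeq A n) n (⌊ellSeq A n⌋).toNat n

/-- `n_start`, the least `n` such that `ε_n ≥ 6/⌊n/ℓ_n⌋`. -/
noncomputable def nStart (A : Type*) [Fintype A] : ℕ :=
  sInf {m : ℕ | 0 < ⌊(m : ℝ) / ellSeq A m⌋ ∧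
    6 / ((⌊(m : ℝ) / ellSeq A m⌋ : ℤ) : ℝ) ≤ epsSeq A m}

/-- `G_n = ⋂_{j=0}^{n} F_{|A|^{n_0+j}}` where `|A|^{n_0} = n_start`. -/
noncomputable def Gn [Fintype A] (S : ℕ → Shuffler A) (n : ℕ) :
    Set ((ℕ → A) × (ℕ → A)) :=
  ⋂ j ∈ Finset.range (n + 1), Fn S (nStart A * Fintype.card A ^ j)



section Streams

variable {α β τ σ : Type*}

/-! ### Prefixes of infinite words -/

theorem pref_length (x : ℕ → α) (n : ℕ) : (pref x n).length = n := by simp [pref]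

theorem pref_zero (x : ℕ → α) : pref x 0 = [] := rfl

theorem pref_succ (x : ℕ → α) (n : ℕ) : pref x (n + 1) = pref x n ++ [x n] := by
  simp [pref, List.range_succ]

theorem pref_add (x : ℕ → α) (m n : ℕ) :
    pref x (m + n) = pref x m ++ pref (fun i => x (m + i)) n := by
  induction n with
  | zero => simp [pref_zero]
  | succ n ih => rw [← add_assoc, pref_succ, ih, pref_succ, List.append_assoc]

theorem pref_getElem (x : ℕ → α) (n i : ℕ) (h : i < (pref x n).length) : (pref x n)[i] = x i := by
  simp [pref]

theorem pref_isPrefix (x : ℕ → α) {m n : ℕ} (h : m ≤ n) : pref x m <+: pref x n := by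
  obtain ⟨k, rfl⟩ := Nat.exists_eq_add_of_le h
  rw [pref_add]; exact List.prefix_append _ _

theorem pref_inj {x x' : ℕ → α} {n : ℕ} (h : pref x n = pref x' n) {i : ℕ} (hi : i < n) :
    x i = x' i := by
  have h1 := pref_getElem x n i (by rwa [pref_length])
  have h2 := pref_getElem x' n i (by rwa [pref_length])
  rw [← h1, ← h2]; simp only [h]

/-- The finite word `l` is a prefix of the infinite word `x`. -/
def Begins (l : List α) (x : ℕ → α) : Prop := l = pref x l.length

theorem begins_pref (x : ℕ → α) (n : ℕ) : Begins (pref x n) x := by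
  simp [Begins, pref_length]

theorem Begins.mono {l l' : List α} {x : ℕ → α} (h : Begins l' x) (hl : l <+: l') :
    Begins l x := by
  rw [Begins] at h ⊢
  have h1 : l <+: pref x l'.length := h ▸ hl
  have h2 := pref_isPrefix x hl.length_le
  exact List.IsPrefix.eq_of_length (List.prefix_of_prefix_length_le h1 h2 (by rw [pref_length]))
    (by rw [pref_length])

theorem Begins.isPrefix {l l' : List α} {x : ℕ → α} (h : Begins l x) (h' : Begins l' x)
    (hl : l.length ≤ l'.length) : l <+: l' := by
  rw [h, h']; exact pref_isPrefix x hl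

theorem Begins.getElem {l : List α} {x : ℕ → α} (h : Begins l x) (i : ℕ) (hi : i < l.length) :
    l[i] = x i := by
  have h1 := pref_getElem x l.length i (by rwa [pref_length])
  rw [← h1]; simp only [Begins] at h; simp only [← h]

theorem Begins.append_singleton {l : List α} {x : ℕ → α} {a : α} (h : Begins (l ++ [a]) x) :
    a = x l.length := by
  have := h.getElem l.length (by simp)
  simpa using this

theorem exists_word (l : ℕ → List α) (hl : ∀ n, l n <+: l (n + 1))
    (hu : ∀ N, ∃ n, N ≤ (l n).length) : ∃ x : ℕ → α, ∀ n, Begins (l n) x := by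
  have hm : ∀ {m n}, m ≤ n → l m <+: l n := fun {m n} h => by
    induction n, h using Nat.le_induction with
    | base => exact List.prefix_rfl
    | succ n _ ih => exact ih.trans (hl n)
  choose N hN using fun k => hu (k + 1)
  refine ⟨fun k => (l (N k))[k]'(hN k), fun n => ?_⟩
  refine List.ext_getElem (by rw [pref_length]) fun i h1 h2 => ?_
  rw [pref_getElem]
  rcases le_total n (N i) with h | h
  · exact (hm h).getElem h1
  · exact ((hm h).getElem (hN i)).symm

/-! ### Concatenation of a finite and an infinite word -/

/-- The concatenation of the finite word `L` and the infinite word `f`. -/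
def cat : List α → (ℕ → α) → ℕ → α
  | [], f => f
  | a :: L, f => fun n => Nat.casesOn n a (cat L f)

theorem cat_cons_succ (a : α) (L : List α) (f : ℕ → α) (n : ℕ) :
    cat (a :: L) f (n + 1) = cat L f n := rfl

theorem pref_cat_cons (a : α) (L : List α) (f : ℕ → α) (n : ℕ) :
    pref (cat (a :: L) f) (n + 1) = a :: pref (cat L f) n := by
  rw [add_comm, pref_add]
  simp only [add_comm 1, cat_cons_succ]
  rfl

theorem pref_cat (L : List α) (f : ℕ → α) (n : ℕ) :
    pref (cat L f) (L.length + n) = L ++ pref f n := by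
  induction L with
  | nil => simp [cat]
  | cons a L ih => rw [List.length_cons, add_right_comm, pref_cat_cons, ih]; rfl

theorem begins_cat {L l : List α} {f : ℕ → α} (h : Begins l f) : Begins (L ++ l) (cat L f) := by
  rw [Begins, List.length_append, pref_cat, ← h]

theorem cat_inj {L L' : List α} {f f' : ℕ → α} (h : cat L f = cat L' f')
    (hl : L.length = L'.length) : L = L' := by
  have h1 := pref_cat L f 0
  have h2 := pref_cat L' f' 0
  simp only [pref_zero, List.append_nil] at h1 h2
  rw [← h1, ← h2, h, hl]

/-! ### Streams produced along a run -/

/-- The word produced by the first `n` letters of `γ` when `f` is the contribution of a letter. -/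
def strm (f : τ → List α) (γ : ℕ → τ) (n : ℕ) : List α := (pref γ n).flatMap f

theorem strm_zero (f : τ → List α) (γ : ℕ → τ) : strm f γ 0 = [] := rfl

theorem strm_succ (f : τ → List α) (γ : ℕ → τ) (n : ℕ) :
    strm f γ (n + 1) = strm f γ n ++ f (γ n) := by
  simp [strm, pref_succ]

theorem strm_add (f : τ → List α) (γ : ℕ → τ) (m n : ℕ) :
    strm f γ (m + n) = strm f γ m ++ strm f (fun i => γ (m + i)) n := by
  simp [strm, pref_add]

theorem strm_mono (f : τ → List α) (γ : ℕ → τ) {m n : ℕ} (h : m ≤ n) :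
    strm f γ m <+: strm f γ n := by
  obtain ⟨k, rfl⟩ := Nat.exists_eq_add_of_le h
  rw [strm_add]; exact List.prefix_append _ _

theorem strm_cat (f : τ → List α) (L : List τ) (γ : ℕ → τ) (n : ℕ) :
    strm f (cat L γ) (L.length + n) = L.flatMap f ++ strm f γ n := by
  simp [strm, pref_cat]

theorem strm_congr {f : τ → List α} {g : σ → List α} {γ : ℕ → τ} {δ : ℕ → σ}
    (h : ∀ n, f (γ n) = g (δ n)) (n : ℕ) : strm f γ n = strm g δ n := by
  induction n with
  | zero => rfl
  | succ n ih => rw [strm_succ, strm_succ, ih, h]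

theorem strm_length_mono (f : τ → List α) (γ : ℕ → τ) : Monotone fun n => (strm f γ n).length :=
  fun _ _ h => (strm_mono f γ h).length_le

/-- The stream produced by `f` along `γ` is infinite. -/
def Unb (f : τ → List α) (γ : ℕ → τ) : Prop := ∀ N, ∃ n, N ≤ (strm f γ n).length

theorem unb_iff (f : τ → List α) (γ : ℕ → τ) :
    Unb f γ ↔ Tendsto (fun n => (strm f γ n).length) atTop atTop :=
  ⟨tendsto_atTop_atTop_of_monotone (strm_length_mono f γ),
    fun h N => (h.eventually_ge_atTop N).exists⟩

theorem Unb.cat {f : τ → List α} {γ : ℕ → τ} (h : Unb f γ) (L : List τ) : Unb f (cat L γ) := by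
  intro N
  obtain ⟨n, hn⟩ := h N
  exact ⟨L.length + n, by rw [strm_cat, List.length_append]; omega⟩

theorem Unb.tail {f : τ → List α} {γ : ℕ → τ} (h : Unb f γ) (m : ℕ) :
    Unb f (fun i => γ (m + i)) := by
  intro N
  obtain ⟨n, hn⟩ := h (N + (strm f γ m).length)
  refine ⟨n, ?_⟩
  have h1 := strm_length_mono f γ (show n ≤ m + n by omega)
  simp only [strm_add, List.length_append] at h1
  omega

/-- The stream produced by `f` along `γ` is the infinite word `x`. -/
def Spells (f : τ → List α) (γ : ℕ → τ) (x : ℕ → α) : Prop :=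
  (∀ n, Begins (strm f γ n) x) ∧ Unb f γ

theorem Spells.cat {f : τ → List α} {γ : ℕ → τ} {x : ℕ → α} (h : Spells f γ x) (L : List τ) :
    Spells f (cat L γ) (cat (L.flatMap f) x) := by
  refine ⟨fun n => ?_, h.2.cat L⟩
  refine Begins.mono ?_ (strm_mono f _ (show n ≤ L.length + n by omega))
  rw [strm_cat]
  exact begins_cat (h.1 n)

theorem Spells.tail {f : τ → List α} {γ : ℕ → τ} {x : ℕ → α} (h : Spells f γ x) (m : ℕ) :
    Spells f (fun i => γ (m + i)) (fun i => x ((strm f γ m).length + i)) := by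
  refine ⟨fun n => ?_, h.2.tail m⟩
  have h1 := h.1 (m + n)
  rw [strm_add, Begins, List.length_append, pref_add] at h1
  exact (List.append_inj h1 (by rw [pref_length])).2

theorem Spells.congr {f : τ → List α} {g : σ → List α} {γ : ℕ → τ} {δ : ℕ → σ} {x : ℕ → α}
    (h : ∀ n, f (γ n) = g (δ n)) (hx : Spells f γ x) : Spells g δ x :=
  ⟨fun n => by rw [← strm_congr h]; exact hx.1 n,
    fun N => by obtain ⟨n, hn⟩ := hx.2 N; exact ⟨n, by rwa [← strm_congr h]⟩⟩

theorem Unb.congr {f : τ → List α} {g : σ → List α} {γ : ℕ → τ} {δ : ℕ → σ}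
    (h : ∀ n, f (γ n) = g (δ n)) (hx : Unb f γ) : Unb g δ :=
  fun N => by obtain ⟨n, hn⟩ := hx N; exact ⟨n, by rwa [← strm_congr h]⟩

/-- Every finite prefix of the stream of `f` along `γ` is a prefix of the stream of `g`
along `δ`. -/
def SubStream (f : τ → List α) (γ : ℕ → τ) (g : σ → List α) (δ : ℕ → σ) : Prop :=
  ∀ n, ∃ m, strm f γ n <+: strm g δ m

theorem SubStream.congr {τ' σ' : Type*} {f : τ → List α} {g : σ → List α} {γ : ℕ → τ}
    {δ : ℕ → σ} {f' : τ' → List α} {g' : σ' → List α} {γ' : ℕ → τ'} {δ' : ℕ → σ'}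
    (h : SubStream f γ g δ) (h1 : ∀ n, f (γ n) = f' (γ' n)) (h2 : ∀ n, g (δ n) = g' (δ' n)) :
    SubStream f' γ' g' δ' := fun n => by
  obtain ⟨m, hm⟩ := h n
  exact ⟨m, by rwa [← strm_congr h1, ← strm_congr h2]⟩

theorem subStream_cat {f : τ → List α} {L L' : List τ} (γ : ℕ → τ)
    (h : L.flatMap f = L'.flatMap f) : SubStream f (cat L γ) f (cat L' γ) := fun n =>
  ⟨L'.length + n, by
    rw [strm_cat, ← h, ← strm_cat]; exact strm_mono f _ (by omega)⟩

end Streams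

/-! ### Runs of two-tape transducers -/

/-- Transitions of a transducer with two input tapes. -/
abbrev Tr (A B D Q : Type*) := Q × (Option A × Option B) × List D × Q

/-- What a transition reads on the first tape. -/
def rd1 (t : Tr A B D Q) : List A := t.2.1.1.toList

/-- What a transition reads on the second tape. -/
def rd2 (t : Tr A B D Q) : List B := t.2.1.2.toList

/-- What a transition writes. -/
def wr (t : Tr A B D Q) : List D := t.2.2.1

/-- `γ` is an infinite path starting in `p` and using transitions in `T`. -/
structure IsRun (T : Set (Tr A B D Q)) (p : Q) (γ : ℕ → Tr A B D Q) : Prop where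
  start : (γ 0).1 = p
  mem : ∀ n, γ n ∈ T
  chain : ∀ n, (γ n).2.2.2 = (γ (n + 1)).1

theorem reduceOption_map_eq_flatMap {α ι : Type*} (l : List ι) (f : ι → Option α) :
    (l.map f).reduceOption = l.flatMap fun i => (f i).toList := by
  induction l with
  | nil => rfl
  | cons a l ih =>
    rw [List.map_cons, List.flatMap_cons, ← ih]
    cases f a <;> simp

theorem c3in1_eq (γ : ℕ → Tr A B D Q) : c3in1 γ = strm rd1 γ := by
  funext n
  rw [c3in1, reduceOption_map_eq_flatMap, strm, pref, List.flatMap_map]; rfl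

theorem c3in2_eq (γ : ℕ → Tr A B D Q) : c3in2 γ = strm rd2 γ := by
  funext n
  rw [c3in2, reduceOption_map_eq_flatMap, strm, pref, List.flatMap_map]; rfl

theorem c3out_eq (γ : ℕ → Tr A B D Q) : c3out γ = strm wr γ := by
  funext n
  rw [c3out, strm, pref, List.flatMap_map]; rfl

theorem Comp3.isAccRunOn_iff (C : Comp3 A B D Q) (γ : ℕ → Tr A B D Q) (x : ℕ → A) (y : ℕ → B) :
    C.IsAccRunOn γ x y ↔
      IsRun C.trans C.init γ ∧ Spells rd1 γ x ∧ Spells rd2 γ y ∧ Unb wr γ := by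
  simp only [Comp3.IsAccRunOn, Spells, unb_iff, c3in1_eq, c3in2_eq, c3out_eq]
  exact ⟨fun ⟨h1, h2, h3, h4, h5, h6, h7, h8⟩ => ⟨⟨h1, h2, h3⟩, ⟨h4, h6⟩, ⟨h5, h7⟩, h8⟩,
    fun ⟨⟨h1, h2, h3⟩, ⟨h4, h6⟩, ⟨h5, h7⟩, h8⟩ => ⟨h1, h2, h3, h4, h5, h6, h7, h8⟩⟩

theorem Comp3.oneToOne_iff (C : Comp3 A B D Q) :
    C.OneToOne ↔ ∀ (x x' : ℕ → A) (y : ℕ → B) γ γ', C.IsAccRunOn γ x y → C.IsAccRunOn γ' x' y →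
      SubStream wr γ wr γ' → SubStream wr γ' wr γ → x = x' := by
  simp only [Comp3.OneToOne, SubStream, c3out_eq]

theorem Comp3.TwoDet.trans_finite [Finite A] [Finite B] [Finite Q] {C : Comp3 A B D Q}
    (h : C.TwoDet) : C.trans.Finite := by
  refine Set.Finite.of_finite_image (f := fun t => (t.1, t.2.1)) (Set.toFinite _) ?_
  intro t ht t' ht' he
  simp only [Prod.mk.injEq] at he
  exact (h t ht t' ht' he.1).2 he.2

/-- The ratio of the lengths of output and first input after `n` transitions. -/
noncomputable def ratio {d : ℕ} [Fintype A] (γ : ℕ → Tr A B (Fin d) Q) (n : ℕ) : ℝ :=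
  (((strm wr γ n).length : ℝ) * Real.log d) /
    (((strm rd1 γ n).length : ℝ) * Real.log (Fintype.card A))

theorem ratio_nonneg {d : ℕ} [Fintype A] (γ : ℕ → Tr A B (Fin d) Q) (n : ℕ) : 0 ≤ ratio γ n := by
  unfold ratio
  have := Real.log_natCast_nonneg d
  have := Real.log_natCast_nonneg (Fintype.card A)
  positivity

/-- The set of conditional compression ratios of `x` given `y`. -/
def condSet [Fintype A] [Fintype B] (x : ℕ → A) (y : ℕ → B) : Set ℝ :=
  {r : ℝ | ∃ (m d : ℕ), 2 ≤ d ∧ ∃ C : Comp3 A B (Fin d) (Fin m),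
    C.TwoDet ∧ C.OneToOne ∧ ∃ γ, C.IsAccRunOn γ x y ∧ r = Filter.liminf (ratio γ) atTop}

theorem condRho_eq [Fintype A] [Fintype B] (x : ℕ → A) (y : ℕ → B) :
    condRho x y = sInf (condSet x y) := by
  simp only [condRho, condSet, c3out_eq, c3in1_eq]
  rfl

theorem Real.liminf_nonneg {u : ℕ → ℝ} (h : ∀ n, 0 ≤ u n) : 0 ≤ Filter.liminf u atTop := by
  rw [Filter.liminf_eq]
  exact Real.sSup_nonneg' ⟨0, Eventually.of_forall h, le_rfl⟩

theorem condSet_nonneg [Fintype A] [Fintype B] {x : ℕ → A} {y : ℕ → B} {r : ℝ}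
    (hr : r ∈ condSet x y) : 0 ≤ r := by
  obtain ⟨m, d, -, C, -, -, γ, -, rfl⟩ := hr
  exact Real.liminf_nonneg (ratio_nonneg γ)

theorem condSet_bddBelow [Fintype A] [Fintype B] (x : ℕ → A) (y : ℕ → B) :
    BddBelow (condSet x y) := ⟨0, fun _ => condSet_nonneg⟩

/-- Renaming of the states of a transition. -/
def Tr.mapState {Q' : Type*} (f : Q → Q') (t : Tr A B D Q) : Tr A B D Q' :=
  (f t.1, t.2.1, t.2.2.1, f t.2.2.2)

theorem mem_condSet [Fintype A] [Fintype B] {x : ℕ → A} {y : ℕ → B} {d : ℕ} (hd : 2 ≤ d)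
    {C : Comp3 A B (Fin d) Q} (hfin : C.trans.Finite) (hdet : C.TwoDet) (hone : C.OneToOne)
    {γ : ℕ → Tr A B (Fin d) Q} (hγ : C.IsAccRunOn γ x y) :
    Filter.liminf (ratio γ) atTop ∈ condSet x y := by
  classical
  set F : Set Q := insert C.init (Prod.fst '' C.trans ∪ (fun t => t.2.2.2) '' C.trans) with hF
  have hFfin : F.Finite := ((hfin.image _).union (hfin.image _)).insert _
  obtain ⟨m, ⟨e⟩⟩ := (Set.finite_coe_iff.2 hFfin).exists_equiv_fin
  have hi : C.init ∈ F := Set.mem_insert _ _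
  have hsrc : ∀ t ∈ C.trans, t.1 ∈ F := fun t ht => Or.inr (Or.inl ⟨t, ht, rfl⟩)
  have htgt : ∀ t ∈ C.trans, t.2.2.2 ∈ F := fun t ht => Or.inr (Or.inr ⟨t, ht, rfl⟩)
  set f : Q → Fin m := fun q => if h : q ∈ F then e ⟨q, h⟩ else e ⟨C.init, hi⟩ with hf
  have hinj : Set.InjOn f F := by
    intro a ha b hb hab
    simp only [hf, ha, hb, dif_pos] at hab
    simpa using e.injective hab
  let C' : Comp3 A B (Fin d) (Fin m) := ⟨f C.init, Tr.mapState f '' C.trans⟩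
  have hpush : ∀ {x : ℕ → A} {γ}, C.IsAccRunOn γ x y →
      C'.IsAccRunOn (fun n => Tr.mapState f (γ n)) x y := by
    intro x γ h
    rw [Comp3.isAccRunOn_iff] at h ⊢
    obtain ⟨⟨h1, h2, h3⟩, h4, h5, h6⟩ := h
    refine ⟨⟨congrArg f h1, fun n => ⟨_, h2 n, rfl⟩, fun n => congrArg f (h3 n)⟩, ?_, ?_, ?_⟩
    · exact h4.congr (by intro n; rfl)
    · exact h5.congr (by intro n; rfl)
    · exact h6.congr (by intro n; rfl)
  have hpull : ∀ {x : ℕ → A} {y : ℕ → B} {γ'}, C'.IsAccRunOn γ' x y →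
      ∃ γ, C.IsAccRunOn γ x y ∧ ∀ n, wr (γ n) = wr (γ' n) := by
    intro x y γ' h
    rw [Comp3.isAccRunOn_iff] at h
    obtain ⟨⟨h1, h2, h3⟩, h4, h5, h6⟩ := h
    choose γ hγ hγ' using h2
    refine ⟨γ, ?_, fun n => by rw [← hγ']; rfl⟩
    rw [Comp3.isAccRunOn_iff]
    refine ⟨⟨?_, hγ, fun n => ?_⟩, ?_, ?_, ?_⟩
    · refine hinj (hsrc _ (hγ 0)) hi ?_
      rw [← hγ'] at h1; exact h1
    · refine hinj (htgt _ (hγ n)) (hsrc _ (hγ (n + 1))) ?_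
      have := h3 n
      rw [← hγ', ← hγ'] at this; exact this
    · exact h4.congr fun n => by rw [← hγ']; rfl
    · exact h5.congr fun n => by rw [← hγ']; rfl
    · exact h6.congr fun n => by rw [← hγ']; rfl
  refine ⟨m, d, hd, C', ?_, ?_, _, hpush hγ, ?_⟩
  · rintro _ ⟨t, ht, rfl⟩ _ ⟨t', ht', rfl⟩ h
    have := hdet t ht t' ht' (hinj (hsrc t ht) (hsrc t' ht') h)
    exact ⟨this.1, fun hl => congrArg _ (this.2 hl)⟩
  · rw [Comp3.oneToOne_iff] at hone ⊢
    intro x x' y γ₁ γ₂ h1 h2 h3 h4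
    obtain ⟨δ₁, hδ₁, e₁⟩ := hpull h1
    obtain ⟨δ₂, hδ₂, e₂⟩ := hpull h2
    exact hone x x' y δ₁ δ₂ hδ₁ hδ₂ (h3.congr (fun n => (e₁ n).symm) fun n => (e₂ n).symm)
      (h4.congr (fun n => (e₂ n).symm) fun n => (e₁ n).symm)
  · congr 1
    funext n
    have e1 : strm wr γ n = strm wr (fun n => Tr.mapState f (γ n)) n :=
      strm_congr (by intro n; rfl) n
    have e2 : strm rd1 γ n = strm rd1 (fun n => Tr.mapState f (γ n)) n :=
      strm_congr (by intro n; rfl) n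
    rw [ratio, ratio, e1, e2]

/-! ### One-tape compressors as two-tape compressors -/

/-- The two-tape transducer that reads one symbol of the second tape at each step and
otherwise behaves as the given one-tape transducer. -/
def Comp2.lift (B : Type*) (C : Comp2 A D Q) : Comp3 A B D Q where
  init := C.init
  trans := {t | ∃ b, t.2.1.2 = some b ∧ (t.1, t.2.1.1, t.2.2.1, t.2.2.2) ∈ C.trans}

/-- The lift of a one-tape run, when the second tape contains `y`. -/
def liftRun (γ : ℕ → Q × Option A × List D × Q) (y : ℕ → B) (n : ℕ) : Tr A B D Q :=
  ((γ n).1, ((γ n).2.1, some (y n)), (γ n).2.2.1, (γ n).2.2.2)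

theorem Comp2.OneDet.lift {C : Comp2 A D Q} (h : C.OneDet) : (C.lift B).TwoDet := by
  rintro ⟨p, ⟨a, b⟩, w, q⟩ ⟨b, hb, ht⟩ ⟨p', ⟨a', b'⟩, w', q'⟩ ⟨b', hb', ht'⟩ he
  dsimp only at *
  subst hb hb'
  obtain ⟨h1, h2⟩ := h _ ht _ ht' he
  refine ⟨?_, fun hl => ?_⟩
  · simp only [lsupp] at *; simp [h1]
  · simp only [Prod.mk.injEq] at *
    have := h2 hl.1
    exact ⟨this.1, hl, this.2.2⟩

theorem strm_rd1_liftRun (γ : ℕ → Q × Option A × List D × Q) (y : ℕ → B) :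
    strm rd1 (liftRun γ y) = c2in γ := by
  funext n
  rw [c2in, reduceOption_map_eq_flatMap, strm, pref, List.flatMap_map]; rfl

theorem strm_wr_liftRun (γ : ℕ → Q × Option A × List D × Q) (y : ℕ → B) :
    strm wr (liftRun γ y) = c2out γ := by
  funext n
  rw [c2out, strm, pref, List.flatMap_map]; rfl

theorem strm_rd2_liftRun (γ : ℕ → Q × Option A × List D × Q) (y : ℕ → B) (n : ℕ) :
    strm rd2 (liftRun γ y) n = pref y n := by
  induction n with
  | zero => rfl
  | succ n ih => rw [strm_succ, ih, pref_succ]; rfl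

theorem Comp2.IsAccRunOn.lift {C : Comp2 A D Q} {γ : ℕ → Q × Option A × List D × Q} {x : ℕ → A}
    (h : C.IsAccRunOn γ x) (y : ℕ → B) : (C.lift B).IsAccRunOn (liftRun γ y) x y := by
  obtain ⟨h1, h2, h3, h4, h5, h6⟩ := h
  rw [Comp3.isAccRunOn_iff]
  refine ⟨⟨h1, fun n => ⟨y n, rfl, h2 n⟩, h3⟩, ⟨fun n => ?_, ?_⟩, ⟨fun n => ?_, fun N => ⟨N, ?_⟩⟩,
    ?_⟩
  · rw [strm_rd1_liftRun]; exact h4 n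
  · rw [unb_iff, strm_rd1_liftRun]; exact h5
  · rw [strm_rd2_liftRun]; exact begins_pref y n
  · rw [strm_rd2_liftRun, pref_length]
  · rw [unb_iff, strm_wr_liftRun]; exact h6

theorem Comp2.OneToOne.lift {C : Comp2 A D Q} (h : C.OneToOne) : (C.lift B).OneToOne := by
  rw [Comp3.oneToOne_iff]
  have key : ∀ {γ : ℕ → Tr A B D Q} {x : ℕ → A} {y : ℕ → B}, (C.lift B).IsAccRunOn γ x y →
      ∃ δ, C.IsAccRunOn δ x ∧ c2out δ = strm wr γ := by
    intro γ x y hγ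
    rw [Comp3.isAccRunOn_iff] at hγ
    obtain ⟨⟨h1, h2, h3⟩, h4, h5, h6⟩ := hγ
    set δ : ℕ → Q × Option A × List D × Q :=
      fun n => ((γ n).1, (γ n).2.1.1, (γ n).2.2.1, (γ n).2.2.2) with hδ
    have e1 : c2in δ = strm rd1 γ := by
      rw [← strm_rd1_liftRun δ y]; funext n; exact strm_congr (by intro n; rfl) n
    have e2 : c2out δ = strm wr γ := by
      rw [← strm_wr_liftRun δ y]; funext n; exact strm_congr (by intro n; rfl) n
    refine ⟨δ, ⟨h1, fun n => ?_, h3, ?_, ?_, ?_⟩, e2⟩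
    · obtain ⟨b, -, hb⟩ := h2 n; exact hb
    · rw [e1]; exact h4.1
    · rw [e1]; exact (unb_iff _ _).1 h4.2
    · rw [e2]; exact (unb_iff _ _).1 h6
  intro x x' y γ γ' h1 h2 h3 h4
  obtain ⟨δ, hδ, e⟩ := key h1
  obtain ⟨δ', hδ', e'⟩ := key h2
  exact h x x' δ δ' hδ hδ' (by rw [e, e']; exact h3) (by rw [e, e']; exact h4)

/-- The set of compression ratios of `x`. -/
def ratioSet [Fintype A] (x : ℕ → A) : Set ℝ :=
  {r : ℝ | ∃ (m d : ℕ), 2 ≤ d ∧ ∃ C : Comp2 A (Fin d) (Fin m),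
    C.OneDet ∧ C.OneToOne ∧ ∃ γ, C.IsAccRunOn γ x ∧
      r = Filter.liminf (fun n : ℕ =>
        (((c2out γ n).length : ℝ) * Real.log d) /
        (((c2in γ n).length : ℝ) * Real.log (Fintype.card A))) atTop}

theorem ratioSet_subset_condSet [Fintype A] [Fintype B] (x : ℕ → A) (y : ℕ → B) :
    ratioSet x ⊆ condSet x y := by
  rintro r ⟨m, d, hd, C, h1, h2, γ, h3, rfl⟩
  refine ⟨m, d, hd, C.lift B, h1.lift, h2.lift, liftRun γ y, h3.lift y, ?_⟩
  congr 1
  funext n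
  rw [ratio, strm_wr_liftRun, strm_rd1_liftRun]

theorem rho_eq [Fintype A] (x : ℕ → A) : rho x = sInf (ratioSet x) := rfl

theorem condRho_le_rho [Fintype A] [Fintype B] (x : ℕ → A) (y : ℕ → B)
    (h : (ratioSet x).Nonempty) : condRho x y ≤ rho x := by
  rw [condRho_eq, rho_eq]
  exact csInf_le_csInf (condSet_bddBelow x y) h (ratioSet_subset_condSet x y)

theorem one_mem_ratioSet [Fintype A] (hA : 2 ≤ Fintype.card A) (x : ℕ → A) : 1 ∈ ratioSet x := by
  let e := Fintype.equivFin A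
  let C : Comp2 A (Fin (Fintype.card A)) (Fin 1) :=
    ⟨0, {t | ∃ a, t = (0, some a, [e a], 0)}⟩
  have hout : ∀ {z : ℕ → A} {γ}, C.IsAccRunOn γ z → ∀ n, c2in γ n = pref z n ∧
      c2out γ n = pref (fun i => e (z i)) n := by
    intro z γ h n
    obtain ⟨h1, h2, h3, h4, h5, h6⟩ := h
    choose a ha using h2
    have hin : ∀ n, c2in γ n = pref a n := by
      intro n
      rw [c2in, reduceOption_map_eq_flatMap]
      simp only [ha, Option.toList_some, pref]
      induction n with
      | zero => rfl
      | succ n ih => simp [List.range_succ, ih]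
    have hz : a = z := by
      funext i
      have := h4 (i + 1)
      rw [hin, pref_length] at this
      exact pref_inj this (Nat.lt_succ_self i)
    subst hz
    refine ⟨hin n, ?_⟩
    rw [c2out]
    simp only [ha, pref]
    induction n with
    | zero => rfl
    | succ n ih => simp [List.range_succ, ih]
  have hlog : 0 < Real.log (Fintype.card A) := Real.log_pos (by exact_mod_cast hA)
  set γ : ℕ → Fin 1 × Option A × List (Fin (Fintype.card A)) × Fin 1 :=
    fun n => (0, some (x n), [e (x n)], 0) with hγ
  have hin : ∀ n, c2in γ n = pref x n := by
    intro n
    rw [c2in, reduceOption_map_eq_flatMap]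
    simp only [hγ, Option.toList_some, pref]
    induction n with
    | zero => rfl
    | succ n ih => simp [List.range_succ, ih]
  have ho : ∀ n, c2out γ n = pref (fun i => e (x i)) n := by
    intro n
    simp only [c2out, hγ, pref]
    induction n with
    | zero => rfl
    | succ n ih => simp [List.range_succ, ih]
  refine ⟨1, Fintype.card A, hA, C, ?_, ?_, γ, ⟨rfl, fun n => ⟨x n, rfl⟩, fun n => rfl, ?_, ?_, ?_⟩,
    ?_⟩
  · rintro _ ⟨a, rfl⟩ _ ⟨a', rfl⟩ -
    exact ⟨rfl, fun h => by simp only [Option.some.injEq] at h; rw [h]⟩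
  · intro z z' γ γ' h h' h1 h2
    funext i
    obtain ⟨m, hm⟩ := h1 (i + 1)
    rw [(hout h _).2, (hout h' _).2] at hm
    have hb : Begins (pref (fun i => e (z i)) (i + 1)) (fun i => e (z' i)) :=
      (begins_pref _ m).mono hm
    rw [Begins, pref_length] at hb
    exact e.injective (pref_inj hb (Nat.lt_succ_self i))
  · intro n; rw [hin]; exact begins_pref x n
  · simp only [hin, pref_length]; exact tendsto_id
  · simp only [ho, pref_length]; exact tendsto_id
  · simp only [hin, ho, pref_length]
    symm
    refine Tendsto.liminf_eq (tendsto_const_nhds.congr' ?_)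
    filter_upwards [eventually_gt_atTop 0] with n hn
    rw [div_self]
    have : (0 : ℝ) < n := by exact_mod_cast hn
    positivity

/-! ### Finite paths and grafting -/

/-- `L` is a path from `p` to `q` with transitions in `T`. -/
def Path (T : Set (Tr A B D Q)) : Q → List (Tr A B D Q) → Q → Prop
  | p, [], q => p = q
  | p, t :: L, q => t ∈ T ∧ t.1 = p ∧ Path T t.2.2.2 L q

theorem Path.append {T : Set (Tr A B D Q)} {p q r : Q} {L L' : List (Tr A B D Q)}
    (h : Path T p L q) (h' : Path T q L' r) : Path T p (L ++ L') r := by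
  induction L generalizing p with
  | nil => cases h; exact h'
  | cons t L ih => exact ⟨h.1, h.2.1, ih h.2.2⟩

theorem Path.mono {T T' : Set (Tr A B D Q)} (hT : T ⊆ T') {p q : Q} {L : List (Tr A B D Q)}
    (h : Path T p L q) : Path T' p L q := by
  induction L generalizing p with
  | nil => exact h
  | cons t L ih => exact ⟨hT h.1, h.2.1, ih h.2.2⟩

theorem Path.getLast? {T : Set (Tr A B D Q)} {p q : Q} {L : List (Tr A B D Q)}
    (h : Path T p L q) (hL : L ≠ []) : L.getLast?.map (fun t => t.2.2.2) = some q := by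
  induction L generalizing p with
  | nil => exact absurd rfl hL
  | cons t L ih =>
    cases L with
    | nil => simpa using (show t.2.2.2 = q from h.2.2)
    | cons t' L => rw [List.getLast?_cons_cons]; exact ih h.2.2 (by simp)

theorem IsRun.tail {T : Set (Tr A B D Q)} {p : Q} {γ : ℕ → Tr A B D Q} (h : IsRun T p γ) (i : ℕ) :
    IsRun T (γ i).1 (fun k => γ (i + k)) :=
  ⟨rfl, fun _ => h.mem _, fun _ => h.chain _⟩

theorem IsRun.path {T : Set (Tr A B D Q)} {p : Q} {γ : ℕ → Tr A B D Q} (h : IsRun T p γ) (n : ℕ) :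
    Path T p (pref γ n) (γ n).1 := by
  induction n with
  | zero => exact h.start.symm
  | succ n ih =>
    rw [pref_succ]
    exact ih.append ⟨h.mem n, rfl, h.chain n⟩

theorem IsRun.cat {T : Set (Tr A B D Q)} {p q : Q} {L : List (Tr A B D Q)} {γ : ℕ → Tr A B D Q}
    (hL : Path T p L q) (h : IsRun T q γ) : IsRun T p (cat L γ) := by
  induction L generalizing p with
  | nil => cases hL; exact h
  | cons t L ih =>
    have := ih hL.2.2
    refine ⟨hL.2.1, fun n => ?_, fun n => ?_⟩
    · cases n with
      | zero => exact hL.1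
      | succ n => exact this.mem n
    · cases n with
      | zero => exact this.start.symm
      | succ n => exact this.chain n

theorem Comp3.IsAccRunOn.graft {C : Comp3 A B D Q} {γ : ℕ → Tr A B D Q} {x : ℕ → A} {y : ℕ → B}
    (h : C.IsAccRunOn γ x y) {i j : ℕ} {L : List (Tr A B D Q)}
    (hL : Path C.trans (γ i).1 L (γ j).1) :
    C.IsAccRunOn (cat (pref γ i ++ L) fun k => γ (j + k))
      (cat (strm rd1 γ i ++ L.flatMap rd1) fun k => x ((strm rd1 γ j).length + k))
      (cat (strm rd2 γ i ++ L.flatMap rd2) fun k => y ((strm rd2 γ j).length + k)) := by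
  rw [Comp3.isAccRunOn_iff] at h ⊢
  obtain ⟨h1, h2, h3, h4⟩ := h
  refine ⟨IsRun.cat ((h1.path i).append hL) (h1.tail j), ?_, ?_, (h4.tail j).cat _⟩
  · have := (h2.tail j).cat (pref γ i ++ L)
    rwa [List.flatMap_append] at this
  · have := (h3.tail j).cat (pref γ i ++ L)
    rwa [List.flatMap_append] at this

/-! ### Aligned blocks of normal words -/

/-- The `j`-th aligned block of length `ℓ` of `y`. -/
def blk {α : Type*} (y : ℕ → α) (ℓ j : ℕ) : List α := pref (fun k => y (j * ℓ + k)) ℓ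

open Classical in
/-- The number of indices `j < n` such that the `j`-th block of `y` is `w`. -/
noncomputable def blkCount {α : Type*} (y : ℕ → α) (w : List α) (n : ℕ) : ℕ :=
  ((Finset.range n).filter fun j => blk y w.length j = w).card

theorem blk_length {α : Type*} (y : ℕ → α) (ℓ j : ℕ) : (blk y ℓ j).length = ℓ := pref_length _ _

theorem drop_take_pref {α : Type*} (y : ℕ → α) (ℓ n j : ℕ) (h : j < n) :
    ((pref y (n * ℓ)).drop (j * ℓ)).take ℓ = blk y ℓ j := by
  obtain ⟨k, rfl⟩ := Nat.exists_eq_add_of_le (Nat.succ_le_of_lt h)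
  have e : (j.succ + k) * ℓ = j * ℓ + (ℓ + k * ℓ) := by rw [Nat.succ_eq_add_one]; ring
  rw [e, pref_add, List.drop_left' (by rw [pref_length]), pref_add,
    List.take_left' (by rw [pref_length])]
  rfl

theorem alocc_eq_blkCount {α : Type*} (y : ℕ → α) (w : List α) (hw : 1 ≤ w.length) (n : ℕ) :
    alocc (pref y (n * w.length)) w = blkCount y w n := by
  classical
  set ℓ := w.length with hℓ
  have : {i : ℕ | i + ℓ ≤ (pref y (n * ℓ)).length ∧ i % ℓ = 0 ∧
      ((pref y (n * ℓ)).drop i).take ℓ = w} =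
      (fun j => j * ℓ) '' (((Finset.range n).filter fun j => blk y ℓ j = w : Finset ℕ) : Set ℕ) := by
    ext i
    simp only [Set.mem_ofPred_eq, pref_length, Set.mem_image, Finset.coe_filter, Finset.mem_range]
    constructor
    · rintro ⟨h1, h2, h3⟩
      obtain ⟨j, rfl⟩ := Nat.dvd_of_mod_eq_zero h2
      have hj : j < n := by
        have : ℓ * (j + 1) ≤ ℓ * n := by rw [Nat.mul_succ, mul_comm ℓ n]; exact h1
        exact Nat.le_of_mul_le_mul_left this hw
      rw [mul_comm ℓ j, drop_take_pref y ℓ n j hj] at h3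
      exact ⟨j, ⟨hj, h3⟩, mul_comm _ _⟩
    · rintro ⟨j, ⟨hj, h3⟩, rfl⟩
      refine ⟨?_, Nat.mul_mod_left _ _, by rw [drop_take_pref y ℓ n j hj, h3]⟩
      calc j * ℓ + ℓ = (j + 1) * ℓ := by ring
        _ ≤ n * ℓ := Nat.mul_le_mul_right _ hj
  have hinj : Function.Injective fun j => j * ℓ := fun a b h => Nat.eq_of_mul_eq_mul_right hw h
  rw [alocc, ← hℓ, this, blkCount, ← hℓ, Nat.card_image_of_injective hinj,
    Nat.card_coe_set_eq, Set.ncard_coe_finset]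

theorem Normal.tendsto_blkCount {α : Type*} [Fintype α] {y : ℕ → α} (hy : Normal y) (w : List α)
    (hw : 1 ≤ w.length) :
    Tendsto (fun n : ℕ => (blkCount y w n : ℝ) / n) atTop
      (𝓝 ((Fintype.card α : ℝ)⁻¹ ^ w.length)) := by
  simpa only [alocc_eq_blkCount y w hw] using hy w.length hw w rfl

theorem Normal.exists_le_blkCount {α : Type*} [Fintype α] {y : ℕ → α} (hy : Normal y) (w : List α)
    (hw : 1 ≤ w.length) : ∃ c : ℕ, ∀ n, n ≤ c * (blkCount y w n + 1) := by
  have : Nonempty α := ⟨y 0⟩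
  have hcard : (0 : ℝ) < Fintype.card α := by exact_mod_cast Fintype.card_pos
  have hβ : 0 < (Fintype.card α : ℝ)⁻¹ ^ w.length := by positivity
  set β := (Fintype.card α : ℝ)⁻¹ ^ w.length
  obtain ⟨N, hN⟩ := eventually_atTop.1
    ((hy.tendsto_blkCount w hw).eventually (lt_mem_nhds (half_lt_self hβ)))
  obtain ⟨c, hc⟩ := exists_nat_gt (2 / β)
  refine ⟨max c (N + 1), fun n => ?_⟩
  rcases lt_or_ge n (N + 1) with h | h
  · calc n ≤ (N + 1) * 1 := by omega
      _ ≤ _ := Nat.mul_le_mul (le_max_right _ _) (by omega)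
  · have h1 := hN n (by omega)
    have hn : (0 : ℝ) < n := by exact_mod_cast (show 0 < n by omega)
    rw [lt_div_iff₀ hn] at h1
    have h2 : (n : ℝ) ≤ c * blkCount y w n := by
      have h3 : (n : ℝ) ≤ 2 / β * blkCount y w n := by
        rw [div_mul_eq_mul_div, le_div_iff₀ hβ]; nlinarith
      exact h3.trans (mul_le_mul_of_nonneg_right hc.le (by positivity))
    have h2' : n ≤ c * blkCount y w n := by exact_mod_cast h2
    exact h2'.trans (Nat.mul_le_mul (le_max_left _ _) (by omega))

/-! ### Progress on the first tape -/

theorem exists_length_eq {τ α : Type*} {f : τ → List α} {γ : ℕ → τ} (hu : Unb f γ)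
    (h1 : ∀ n, (f (γ n)).length ≤ 1) (N : ℕ) : ∃ n, (strm f γ n).length = N := by
  induction N with
  | zero => exact ⟨0, rfl⟩
  | succ N ih =>
    classical
    have hex := hu (N + 1)
    have hs := Nat.find_spec hex
    have hm := fun m => Nat.find_min hex (m := m)
    set n := Nat.find hex
    rcases Nat.eq_zero_or_pos n with h0 | h0
    · rw [h0, strm_zero] at hs; simp at hs
    · refine ⟨n, ?_⟩
      have h2 := hm (n - 1) (by omega)
      have h3 := strm_succ f γ (n - 1)
      rw [Nat.sub_add_cancel h0] at h3
      have h4 := h1 (n - 1)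
      rw [h3, List.length_append] at hs ⊢
      omega

theorem length_rd1_le (t : Tr A B D Q) : (rd1 t).length ≤ 1 := by
  unfold rd1; cases t.2.1.1 <;> simp

theorem length_rd2_le (t : Tr A B D Q) : (rd2 t).length ≤ 1 := by
  unfold rd2; cases t.2.1.2 <;> simp

theorem exists_nonempty_ge {τ α : Type*} {f : τ → List α} {γ : ℕ → τ} (hu : Unb f γ) (n : ℕ) :
    ∃ m, n ≤ m ∧ f (γ m) ≠ [] := by
  by_contra! hcon
  obtain ⟨k, hk⟩ := hu ((strm f γ n).length + 1)
  have : ∀ j, (strm f γ (n + j)).length = (strm f γ n).length := by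
    intro j
    induction j with
    | zero => rfl
    | succ j ih => rw [← add_assoc, strm_succ, hcon (n + j) (by omega), List.append_nil, ih]
  have h1 := strm_length_mono f γ (show k ≤ n + k by omega)
  have h2 := this k
  simp only at h1
  omega

theorem rd1_ne_nil {t : Tr A B D Q} : rd1 t ≠ [] ↔ t.2.1.1.isSome := by
  unfold rd1; cases t.2.1.1 <;> simp

section Progress

variable {C : Comp3 A B D Q} {γ : ℕ → Tr A B D Q} {p : Q} {y : ℕ → B}

/-- Every time the run `γ` is in state `q` and the unread part of the second tape starts with `w`,
the run reads the first tape before consuming `w`. -/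
def Forces (γ : ℕ → Tr A B D Q) (y : ℕ → B) (w : List B) (q : Q) : Prop :=
  ∀ n, (γ n).1 = q → Begins w (fun k => y ((strm rd2 γ n).length + k)) →
    ∃ m, n ≤ m ∧ (strm rd2 γ m).length < (strm rd2 γ n).length + w.length ∧ rd1 (γ m) ≠ []

theorem Forces.append {w : List B} {q : Q} (h : Forces γ y w q) (v : List B) :
    Forces γ y (w ++ v) q := by
  intro n hn hw
  obtain ⟨m, h1, h2, h3⟩ := h n hn (hw.mono (List.prefix_append _ _))
  exact ⟨m, h1, by rw [List.length_append]; omega, h3⟩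

theorem Spells.head_rd2 (h : Spells rd2 γ y) (n : ℕ) {b : B} (hb : (γ n).2.1.2 = some b) :
    b = y (strm rd2 γ n).length := by
  have := h.1 (n + 1)
  rw [strm_succ, show rd2 (γ n) = [b] by simp [rd2, hb]] at this
  exact this.append_singleton

theorem Spells.head_rd1 {x : ℕ → A} (h : Spells rd1 γ x) (n : ℕ) {a : A}
    (ha : (γ n).2.1.1 = some a) : a = x (strm rd1 γ n).length := by
  have := h.1 (n + 1)
  rw [strm_succ, show rd1 (γ n) = [a] by simp [rd1, ha]] at this
  exact this.append_singleton

theorem exists_forces_append (hdet : C.TwoDet) (hrun : IsRun C.trans p γ)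
    (hy : Spells rd2 γ y) (hu : Unb rd1 γ) (w : List B) (q : Q) :
    ∃ v, Forces γ y (w ++ v) q := by
  classical
  by_cases hocc : ∃ n, (γ n).1 = q ∧ Begins w (fun k => y ((strm rd2 γ n).length + k))
  swap
  · push Not at hocc
    exact ⟨[], fun n hn hw => absurd (hw.mono (List.prefix_append _ _)) (hocc n hn)⟩
  obtain ⟨n, hn, hw⟩ := hocc
  have hex := exists_nonempty_ge hu n
  have hspec := Nat.find_spec hex
  have hmin := fun m => Nat.find_min hex (m := m)
  set n' := Nat.find hex
  set K := max w.length ((strm rd2 γ n').length - (strm rd2 γ n).length) + 1 with hK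
  obtain ⟨v, hv⟩ := hw.isPrefix (begins_pref (fun k => y ((strm rd2 γ n).length + k)) K)
    (by rw [pref_length]; omega)
  refine ⟨v, ?_⟩
  rw [hv]
  intro m hm hW
  rw [Begins, pref_length] at hW
  have hWe : ∀ i < K, y ((strm rd2 γ n).length + i) = y ((strm rd2 γ m).length + i) :=
    fun i hi => pref_inj hW hi
  have key : ∀ k, n + k ≤ n' → (γ (m + k)).1 = (γ (n + k)).1 ∧
      (strm rd2 γ (m + k)).length + (strm rd2 γ n).length =
        (strm rd2 γ (n + k)).length + (strm rd2 γ m).length := by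
    intro k
    induction k with
    | zero => intro _; exact ⟨hm.trans hn.symm, by simp only [add_zero]; omega⟩
    | succ k ih =>
      intro hk
      obtain ⟨i1, i2⟩ := ih (by omega)
      have hn1 : rd1 (γ (n + k)) = [] := by
        by_contra hne; exact hmin (n + k) (by omega) ⟨by omega, hne⟩
      have hnone : (γ (n + k)).2.1.1 = none := by
        simpa [rd1] using hn1
      obtain ⟨s1, s2⟩ := hdet _ (hrun.mem (m + k)) _ (hrun.mem (n + k)) i1
      simp only [lsupp, Prod.mk.injEq, hnone, Option.isSome_none, Option.isSome_eq_false_iff,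
        Option.isNone_iff_eq_none] at s1
      have hlab : (γ (m + k)).2.1.2 = (γ (n + k)).2.1.2 := by
        cases hb : (γ (n + k)).2.1.2 with
        | none => simpa [hb] using s1.2
        | some b =>
          have h3 : ((γ (m + k)).2.1.2).isSome := by rw [s1.2, hb]; rfl
          obtain ⟨b', hb'⟩ := Option.isSome_iff_exists.1 h3
          rw [hb', hy.head_rd2 _ hb, hy.head_rd2 _ hb']
          have h4 := strm_length_mono (rd2 : Tr A B D Q → List B) γ
            (show n + (k + 1) ≤ n' by omega)
          have h5 := strm_length_mono (rd2 : Tr A B D Q → List B) γ (show n ≤ n + k by omega)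
          simp only [← add_assoc, strm_succ, List.length_append] at h4 h5
          have h6 : (rd2 (γ (n + k))).length = 1 := by simp [rd2, hb]
          have h7 := hWe ((strm rd2 γ (n + k)).length - (strm rd2 γ n).length) (by omega)
          rw [show (strm rd2 γ n).length + ((strm rd2 γ (n + k)).length - (strm rd2 γ n).length)
            = (strm rd2 γ (n + k)).length by omega] at h7
          rw [show (strm rd2 γ m).length + ((strm rd2 γ (n + k)).length - (strm rd2 γ n).length)
            = (strm rd2 γ (m + k)).length by omega] at h7
          rw [h7]
      have heq : γ (m + k) = γ (n + k) := s2 (Prod.ext (s1.1.trans hnone.symm) hlab)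
      refine ⟨?_, ?_⟩
      · rw [← add_assoc, ← add_assoc, ← hrun.chain, ← hrun.chain, heq]
      · rw [← add_assoc, ← add_assoc, strm_succ, strm_succ, List.length_append,
          List.length_append, heq]
        omega
  obtain ⟨k1, k2⟩ := key (n' - n) (by omega)
  rw [show n + (n' - n) = n' by omega] at k1 k2
  refine ⟨m + (n' - n), by omega, ?_, ?_⟩
  · rw [pref_length]; omega
  · have s1 := (hdet _ (hrun.mem (m + (n' - n))) _ (hrun.mem n') k1).1
    simp only [lsupp, Prod.mk.injEq] at s1
    rw [rd1_ne_nil, s1.1, ← rd1_ne_nil]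
    exact hspec.2

theorem exists_forces_all [Finite Q] (hdet : C.TwoDet) (hrun : IsRun C.trans p γ)
    (hy : Spells rd2 γ y) (hu : Unb rd1 γ) : ∃ w, 1 ≤ w.length ∧ ∀ q, Forces γ y w q := by
  have h : ∀ s : Set Q, s.Finite → ∃ w, ∀ q ∈ s, Forces γ y w q := by
    intro s hs
    induction s, hs using Set.Finite.induction_on with
    | empty => exact ⟨[], fun q hq => absurd hq (Set.notMem_empty q)⟩
    | insert _ _ ih =>
      rename_i a s _ _
      obtain ⟨w, hw⟩ := ih
      obtain ⟨v, hv⟩ := exists_forces_append hdet hrun hy hu w a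
      refine ⟨w ++ v, ?_⟩
      rintro q (rfl | hq)
      · exact hv
      · exact (hw q hq).append v
  obtain ⟨w, hw⟩ := h Set.univ Set.finite_univ
  refine ⟨w, ?_, fun q => hw q trivial⟩
  by_contra hlt
  have hnil : w = [] := List.length_eq_zero_iff.1 (by omega)
  subst hnil
  obtain ⟨m, h1, h2, -⟩ := hw (γ 0).1 trivial 0 rfl rfl
  have := strm_length_mono (rd2 : Tr A B D Q → List B) γ h1
  simp only [List.length_nil, add_zero] at *
  omega

theorem length_strm_eq_card {τ α : Type*} {f : τ → List α} {γ : ℕ → τ}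
    (h1 : ∀ n, (f (γ n)).length ≤ 1) (n : ℕ) [DecidablePred fun i => f (γ i) ≠ []] :
    (strm f γ n).length = ((Finset.range n).filter fun i => f (γ i) ≠ []).card := by
  induction n with
  | zero => rfl
  | succ n ih =>
    rw [strm_succ, List.length_append, ih, Finset.range_add_one, Finset.filter_insert]
    have := h1 n
    split_ifs with h
    · rw [Finset.card_insert_of_notMem (by simp)]
      have := List.length_pos_iff.2 h
      omega
    · rw [not_ne_iff.1 h]; simp

theorem exists_length_rd2_le [Fintype B] [Finite Q] (hdet : C.TwoDet) (hrun : IsRun C.trans p γ)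
    (hy : Spells rd2 γ y) (hu : Unb rd1 γ) (hn : Normal y) :
    ∃ c : ℕ, ∀ n, (strm rd2 γ n).length ≤ c * ((strm rd1 γ n).length + 1) := by
  classical
  obtain ⟨w, hw1, hw⟩ := exists_forces_all hdet hrun hy hu
  obtain ⟨c, hc⟩ := hn.exists_le_blkCount w hw1
  have hblk : ∀ n, blkCount y w ((strm rd2 γ n).length / w.length) ≤ (strm rd1 γ n).length := by
    intro n
    have hex : ∀ j, blk y w.length j = w → ∃ m, j * w.length ≤ (strm rd2 γ m).length ∧
        (strm rd2 γ m).length < j * w.length + w.length ∧ rd1 (γ m) ≠ [] := by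
      intro j hj
      obtain ⟨t, ht⟩ := exists_length_eq hy.2 (fun n => length_rd2_le (γ n)) (j * w.length)
      obtain ⟨m, h1, h2, h3⟩ := hw _ t rfl (by rw [ht]; exact hj.symm)
      have := strm_length_mono (rd2 : Tr A B D Q → List B) γ h1
      simp only at this
      exact ⟨m, by omega, by omega, h3⟩
    choose! m hm1 hm2 hm3 using hex
    rw [length_strm_eq_card (fun n => length_rd1_le (γ n)), blkCount]
    refine Finset.card_le_card_of_injOn m ?_ ?_
    · intro j hj
      simp only [Finset.coe_filter, Finset.mem_range, Set.mem_ofPred_eq] at hj ⊢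
      refine ⟨?_, hm3 j hj.2⟩
      by_contra hlt
      have h1 := strm_length_mono (rd2 : Tr A B D Q → List B) γ (not_lt.1 hlt)
      have h2 := hm2 j hj.2
      have h3 : (j + 1) * w.length ≤ (strm rd2 γ n).length :=
        (Nat.mul_le_mul_right _ hj.1).trans (Nat.div_mul_le_self _ _)
      rw [add_mul, one_mul] at h3
      simp only at h1
      omega
    · intro j hj j' hj' he
      simp only [Finset.coe_filter, Finset.mem_range, Set.mem_ofPred_eq] at hj hj'
      have e1 := Nat.div_eq_of_lt_le (hm1 j hj.2) (by rw [add_mul, one_mul]; exact hm2 j hj.2)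
      have e2 := Nat.div_eq_of_lt_le (hm1 j' hj'.2) (by rw [add_mul, one_mul]; exact hm2 j' hj'.2)
      rw [← e1, ← e2, he]
  refine ⟨w.length * (c + 1), fun n => ?_⟩
  have h1 := (hc _).trans (Nat.mul_le_mul_left c (Nat.add_le_add_right (hblk n) 1))
  have h2 := Nat.lt_div_mul_add (a := (strm rd2 γ n).length) (b := w.length) (by omega)
  calc (strm rd2 γ n).length ≤ w.length * ((strm rd2 γ n).length / w.length + 1) := by
        rw [mul_add, mul_one, mul_comm]; exact h2.le
    _ ≤ w.length * (c * ((strm rd1 γ n).length + 1) + ((strm rd1 γ n).length + 1)) :=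
        Nat.mul_le_mul_left _ (by omega)
    _ = _ := by ring

theorem exists_reads [Fintype Q] (hdet : C.TwoDet) (hrun : IsRun C.trans p γ) (hu : Unb rd1 γ)
    (n : ℕ) : ∃ m, n ≤ m ∧ m ≤ n + Fintype.card Q ∧ (γ m).2.1 ≠ (none, none) := by
  by_contra! hcon
  obtain ⟨a, b, hab, he⟩ := Fintype.exists_ne_map_eq_of_card_lt
    (fun i : Fin (Fintype.card Q + 1) => (γ (n + i)).1) (by simp)
  wlog hlt : a < b generalizing a b
  · exact this b a hab.symm he.symm (lt_of_le_of_ne (not_lt.1 hlt) hab.symm)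
  have hlt' : (a : ℕ) < b := hlt
  have hbb := b.2
  have hP : ∀ k, (γ (n + a + k)).2.1 = (none, none) ∧ (γ (n + b + k)).1 = (γ (n + a + k)).1 := by
    intro k
    induction k using Nat.strong_induction_on with
    | _ k ih =>
      have hst : (γ (n + b + k)).1 = (γ (n + a + k)).1 := by
        cases k with
        | zero => exact he.symm
        | succ k =>
          obtain ⟨i1, i2⟩ := ih k (by omega)
          obtain ⟨s1, s2⟩ := hdet _ (hrun.mem (n + b + k)) _ (hrun.mem (n + a + k)) i2
          rw [i1] at s1 s2
          have : (γ (n + b + k)).2.1 = (none, none) := by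
            simpa [lsupp, Prod.ext_iff] using s1
          rw [← add_assoc, ← add_assoc, ← hrun.chain, ← hrun.chain, s2 this]
      refine ⟨?_, hst⟩
      rcases lt_or_ge k (b - a) with hk | hk
      · exact hcon _ (by omega) (by omega)
      · obtain ⟨i1, i2⟩ := ih (k - (b - a)) (by omega)
        rw [show n + (b : ℕ) + (k - (b - a)) = n + a + k by omega] at i2
        have s1 := (hdet _ (hrun.mem _) _ (hrun.mem _) i2).1
        rw [i1] at s1
        simpa [lsupp, Prod.ext_iff] using s1
  obtain ⟨m, h1, h2⟩ := exists_nonempty_ge hu (n + a)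
  have := (hP (m - (n + a))).1
  rw [show n + (a : ℕ) + (m - (n + a)) = m by omega] at this
  exact h2 (by simp [rd1, this])

theorem exists_le_mul_length_rd1 [Fintype B] [Finite Q] (hdet : C.TwoDet)
    (hrun : IsRun C.trans p γ) (hy : Spells rd2 γ y) (hu : Unb rd1 γ) (hn : Normal y) :
    ∃ c : ℕ, ∀ n, n ≤ c * ((strm rd1 γ n).length + 1) := by
  have := Fintype.ofFinite Q
  obtain ⟨c, hc⟩ := exists_length_rd2_le hdet hrun hy hu hn
  set s := Fintype.card Q + 1 with hs
  have h : ∀ k, k ≤ (strm rd1 γ (k * s)).length + (strm rd2 γ (k * s)).length := by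
    intro k
    induction k with
    | zero => omega
    | succ k ih =>
      obtain ⟨m, h1, h2, h3⟩ := exists_reads hdet hrun hu (k * s)
      have a1 := strm_length_mono (rd1 : Tr A B D Q → List A) γ h1
      have a2 := strm_length_mono (rd2 : Tr A B D Q → List B) γ h1
      have hm : m + 1 ≤ (k + 1) * s := by rw [add_mul, one_mul]; omega
      have b1 := strm_length_mono (rd1 : Tr A B D Q → List A) γ hm
      have b2 := strm_length_mono (rd2 : Tr A B D Q → List B) γ hm
      simp only [strm_succ, List.length_append] at a1 a2 b1 b2
      have : 1 ≤ (rd1 (γ m)).length + (rd2 (γ m)).length := by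
        rcases hl : (γ m).2.1 with ⟨_ | a, _ | b⟩
        · exact absurd hl h3
        all_goals simp [rd1, rd2, hl]
      omega
  refine ⟨s * (c + 1), fun n => ?_⟩
  have h1 := h (n / s)
  have h2 := Nat.div_mul_le_self n s
  have h3 := strm_length_mono (rd1 : Tr A B D Q → List A) γ h2
  have h4 := strm_length_mono (rd2 : Tr A B D Q → List B) γ h2
  have h5 := hc n
  have h6 := Nat.lt_div_mul_add (a := n) (b := s) (by omega)
  simp only at h3 h4
  calc n ≤ s * (n / s + 1) := by rw [mul_add, mul_one, mul_comm]; exact h6.le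
    _ ≤ s * ((c + 1) * ((strm rd1 γ n).length + 1)) :=
        Nat.mul_le_mul_left _ (by rw [add_mul, one_mul]; omega)
    _ = _ := by ring

end Progress

/-! ### Local injectivity -/

/-- The transducer is injective in its first input once the second input, the output and the
additional stream `g` are fixed. -/
def Comp3.InjWith {E : Type*} (C : Comp3 A B D Q) (g : Tr A B D Q → List E) : Prop :=
  ∀ (x x' : ℕ → A) (y : ℕ → B) γ γ', C.IsAccRunOn γ x y → C.IsAccRunOn γ' x' y →
    SubStream wr γ wr γ' → SubStream wr γ' wr γ → SubStream g γ g γ' → SubStream g γ' g γ → x = x'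

theorem Comp3.OneToOne.injWith {C : Comp3 A B D Q} (h : C.OneToOne) : C.InjWith wr :=
  fun x x' y γ γ' h1 h2 h3 h4 _ _ => C.oneToOne_iff.1 h x x' y γ γ' h1 h2 h3 h4

theorem IsRun.path_sub {T : Set (Tr A B D Q)} {p : Q} {γ : ℕ → Tr A B D Q} (h : IsRun T p γ)
    {i j : ℕ} (hij : i ≤ j) : Path T (γ i).1 (pref (fun k => γ (i + k)) (j - i)) (γ j).1 := by
  have := (h.tail i).path (j - i)
  rwa [show i + (j - i) = j by omega] at this

theorem Comp3.InjWith.eq_of_path {E : Type*} {C : Comp3 A B D Q} {g : Tr A B D Q → List E}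
    (hC : C.InjWith g) {γ : ℕ → Tr A B D Q} {x : ℕ → A} {y : ℕ → B} (h : C.IsAccRunOn γ x y)
    {i j : ℕ} {L L' : List (Tr A B D Q)} (hL : Path C.trans (γ i).1 L (γ j).1)
    (hL' : Path C.trans (γ i).1 L' (γ j).1)
    (h2 : ∀ l f, cat (l ++ L.flatMap rd2) f = cat (l ++ L'.flatMap rd2) f)
    (hw : L.flatMap wr = L'.flatMap wr) (hg : L.flatMap g = L'.flatMap g)
    (hlen : (L.flatMap rd1).length = (L'.flatMap rd1).length) :
    L.flatMap rd1 = L'.flatMap rd1 := by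
  have a1 := h.graft hL
  have a2 := h.graft hL'
  rw [← h2] at a2
  have hs : ∀ {F : Type _} (f : Tr A B D Q → List F) {M M' : List (Tr A B D Q)},
      M.flatMap f = M'.flatMap f →
      SubStream f (cat (pref γ i ++ M) fun k => γ (j + k)) f
        (cat (pref γ i ++ M') fun k => γ (j + k)) := by
    intro F f M M' hM
    exact subStream_cat _ (by rw [List.flatMap_append, List.flatMap_append, hM])
  have hs' : ∀ (f : Tr A B D Q → List E) {M M' : List (Tr A B D Q)},
      M.flatMap f = M'.flatMap f →
      SubStream f (cat (pref γ i ++ M) fun k => γ (j + k)) f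
        (cat (pref γ i ++ M') fun k => γ (j + k)) := by
    intro f M M' hM
    exact subStream_cat _ (by rw [List.flatMap_append, List.flatMap_append, hM])
  have := hC _ _ _ _ _ a1 a2 (hs wr hw) (hs wr hw.symm) (hs' g hg) (hs' g hg.symm)
  have := cat_inj this (by rw [List.length_append, List.length_append, hlen])
  exact List.append_cancel_left this

/-! ### Boundedness of the ratio -/

theorem exists_wr_length_le {T : Set (Tr A B D Q)} (hT : T.Finite) {p : Q} {γ : ℕ → Tr A B D Q}
    (h : IsRun T p γ) : ∃ M : ℕ, ∀ n, (strm wr γ n).length ≤ n * M := by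
  obtain ⟨M, hM⟩ := (hT.image fun t => (wr t).length).bddAbove
  refine ⟨M, fun n => ?_⟩
  induction n with
  | zero => simp [strm_zero]
  | succ n ih =>
    have := hM ⟨_, h.mem n, rfl⟩
    rw [strm_succ, List.length_append, add_mul, one_mul]
    exact add_le_add ih this

theorem exists_ratio_le {d : ℕ} [Fintype A] [Fintype B] [Finite Q] {C : Comp3 A B (Fin d) Q}
    (hdet : C.TwoDet) {γ : ℕ → Tr A B (Fin d) Q} {x : ℕ → A} {y : ℕ → B}
    (h : C.IsAccRunOn γ x y) (hy : Normal y) : ∃ M, ∀ n, ratio γ n ≤ M := by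
  rw [Comp3.isAccRunOn_iff] at h
  obtain ⟨h1, h2, h3, -⟩ := h
  obtain ⟨c, hc⟩ := exists_le_mul_length_rd1 hdet h1 h3 h2.2 hy
  obtain ⟨M, hM⟩ := exists_wr_length_le hdet.trans_finite h1
  have hd := Real.log_natCast_nonneg d
  have hA := Real.log_natCast_nonneg (Fintype.card A)
  refine ⟨(2 * c * M : ℕ) * Real.log d / Real.log (Fintype.card A), fun n => ?_⟩
  unfold ratio
  rcases Nat.eq_zero_or_pos (strm rd1 γ n).length with h0 | h0
  · rw [h0]; simp only [Nat.cast_zero, zero_mul, div_zero]; positivity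
  · rw [← div_div, mul_div_right_comm]
    refine div_le_div_of_nonneg_right (mul_le_mul_of_nonneg_right ?_ hd) hA
    rw [div_le_iff₀ (by exact_mod_cast h0)]
    have : (strm wr γ n).length ≤ 2 * c * M * (strm rd1 γ n).length := by
      calc _ ≤ n * M := hM n
        _ ≤ (c * ((strm rd1 γ n).length + (strm rd1 γ n).length)) * M :=
          Nat.mul_le_mul_right _ ((hc n).trans (Nat.mul_le_mul_left _ (by omega)))
        _ = _ := by ring
    exact_mod_cast this

/-! ### Normal words are incompressible -/

theorem normal_unit : Normal (fun _ : ℕ => ()) := by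
  intro ℓ hℓ w hw
  subst hw
  simp only [alocc_eq_blkCount _ w hℓ]
  refine (tendsto_const_nhds (x := (1 : ℝ))).congr' ?_ |>.trans (by simp)
  filter_upwards [eventually_gt_atTop 0] with n hn
  have : blkCount (fun _ : ℕ => ()) w n = n := by
    have hall : ∀ j, blk (fun _ : ℕ => ()) w.length j = w := fun j =>
      List.ext_getElem (blk_length _ _ _) (by intros; rfl)
    simp [blkCount, hall]
  rw [this, div_self (by exact_mod_cast hn.ne')]

theorem card_lists_le (d m : ℕ) (hd : 1 ≤ d) :
    ∃ F : Finset (List (Fin d)), F.card ≤ (m + 1) * d ^ m ∧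
      ∀ l : List (Fin d), l.length ≤ m → l ∈ F := by
  classical
  refine ⟨(Finset.range (m + 1)).biUnion fun k =>
    (Finset.univ : Finset (Fin k → Fin d)).image List.ofFn, ?_, ?_⟩
  · refine (Finset.card_biUnion_le_card_mul _ _ (d ^ m) fun k hk => ?_).trans (by simp)
    refine Finset.card_image_le.trans ?_
    rw [Finset.card_univ, Fintype.card_fun, Fintype.card_fin, Fintype.card_fin]
    exact Nat.pow_le_pow_right hd (by simpa [Nat.lt_succ_iff] using hk)
  · intro l hl
    simp only [Finset.mem_biUnion, Finset.mem_range, Finset.mem_image]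
    exact ⟨l.length, by omega, l.get, Finset.mem_univ _, List.ofFn_get l⟩

theorem exists_block_params {b d : ℕ} (hb : 2 ≤ b) (hd : 2 ≤ d) (N : ℕ) {ρ δ : ℝ} (hρ0 : 0 < ρ)
    (hρ : ρ < 1) (hδ : 0 < δ) : ∃ ℓ m : ℕ, 1 ≤ ℓ ∧ ρ * ℓ * Real.log b ≤ m * Real.log d ∧
      (N * ((m + 1) * d ^ m) : ℕ) * ((b : ℝ)⁻¹) ^ ℓ < δ := by
  have hb' : 0 < Real.log b := Real.log_pos (by exact_mod_cast hb)
  have hd' : 0 < Real.log d := Real.log_pos (by exact_mod_cast hd)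
  have hb0 : (0 : ℝ) < b := by positivity
  have hd0 : (0 : ℝ) < d := by positivity
  set a := ρ * Real.log b / Real.log d with ha
  have ha0 : 0 < a := by positivity
  set r := Real.exp (-(1 - ρ) * Real.log b) with hr
  have hr1 : r < 1 := by
    rw [hr, Real.exp_lt_one_iff]; nlinarith
  have hlim : Tendsto (fun ℓ : ℕ => (N * d : ℝ) * (a * (ℓ * r ^ ℓ) + 2 * r ^ ℓ)) atTop (𝓝 0) := by
    have h1 := tendsto_self_mul_const_pow_of_lt_one (Real.exp_pos _).le hr1
    have h2 := tendsto_pow_atTop_nhds_zero_of_lt_one (Real.exp_pos _).le hr1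
    have h3 := ((h1.const_mul a).add (h2.const_mul 2)).const_mul (N * d : ℝ)
    simp only [mul_zero, add_zero] at h3
    exact h3
  obtain ⟨ℓ, hℓ, hℓ1⟩ := ((hlim.eventually (gt_mem_nhds hδ)).and (eventually_ge_atTop 1)).exists
  refine ⟨ℓ, ⌈a * ℓ⌉₊, hℓ1, ?_, lt_of_le_of_lt ?_ hℓ⟩
  · have := Nat.le_ceil (a * ℓ)
    calc ρ * ℓ * Real.log b = a * ℓ * Real.log d := by rw [ha]; field_simp
      _ ≤ _ := mul_le_mul_of_nonneg_right this hd'.le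
  · set m := ⌈a * ℓ⌉₊
    have hm : (m : ℝ) < a * ℓ + 1 := Nat.ceil_lt_add_one (by positivity)
    have hdm : (d : ℝ) ^ m * ((b : ℝ)⁻¹) ^ ℓ ≤ d * r ^ ℓ := by
      have e1 : (d : ℝ) ^ m = Real.exp (m * Real.log d) := by
        rw [Real.exp_nat_mul, Real.exp_log hd0]
      have e2 : ((b : ℝ)⁻¹) ^ ℓ = Real.exp (-(ℓ * Real.log b)) := by
        rw [Real.exp_neg, Real.exp_nat_mul, Real.exp_log hb0, inv_pow]
      have e3 : (d : ℝ) * r ^ ℓ = Real.exp (Real.log d + ℓ * (-(1 - ρ) * Real.log b)) := by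
        rw [Real.exp_add, Real.exp_log hd0, hr, Real.exp_nat_mul]
      rw [e1, e2, e3, ← Real.exp_add, Real.exp_le_exp]
      have : (m : ℝ) * Real.log d ≤ (a * ℓ + 1) * Real.log d :=
        mul_le_mul_of_nonneg_right hm.le hd'.le
      have e4 : (a * ℓ + 1) * Real.log d = ρ * ℓ * Real.log b + Real.log d := by
        rw [ha]; field_simp
      linarith
    push_cast
    calc (N * ((m + 1) * d ^ m) : ℝ) * ((b : ℝ)⁻¹) ^ ℓ
        = (N * (m + 1)) * (d ^ m * ((b : ℝ)⁻¹) ^ ℓ) := by ring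
      _ ≤ (N * (a * ℓ + 2)) * (d * r ^ ℓ) := by
          refine mul_le_mul (mul_le_mul_of_nonneg_left (by linarith) (by positivity)) hdm
            (by positivity) (by positivity)
      _ = _ := by ring

theorem flatMap_pref_sub {τ α : Type*} (f : τ → List α) (γ : ℕ → τ) {i j : ℕ} (h : i ≤ j) :
    strm f γ i ++ (pref (fun k => γ (i + k)) (j - i)).flatMap f = strm f γ j := by
  have := strm_add f γ i (j - i)
  rw [show i + (j - i) = j by omega] at this
  exact this.symm

theorem exists_short_blocks {d : ℕ} (hd : 1 ≤ d) [Fintype Q] {C : Comp3 A Unit (Fin d) Q}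
    (hone : C.OneToOne) {γ : ℕ → Tr A Unit (Fin d) Q} {x : ℕ → A} {y : ℕ → Unit}
    (h : C.IsAccRunOn γ x y) {ℓ : ℕ} (hℓ : 1 ≤ ℓ) (m : ℕ) {t : ℕ → ℕ}
    (ht : ∀ j, (strm rd1 γ (t j)).length = j * ℓ) :
    ∃ W : Finset (List A), W.card ≤ Fintype.card Q * Fintype.card Q * ((m + 1) * d ^ m) ∧
      (∀ w ∈ W, w.length = ℓ) ∧
      ∀ j, (strm wr γ (t (j + 1))).length ≤ (strm wr γ (t j)).length + m → blk x ℓ j ∈ W := by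
  classical
  obtain ⟨F, hF, hFm⟩ := card_lists_le d m hd
  have hrun := ((C.isAccRunOn_iff _ _ _).1 h).1
  have hx := ((C.isAccRunOn_iff _ _ _).1 h).2.1
  have hmono : ∀ j, t j ≤ t (j + 1) := by
    intro j
    by_contra hlt
    have h1 := strm_length_mono (rd1 : Tr A Unit (Fin d) Q → List A) γ (not_le.1 hlt).le
    simp only [ht, add_mul, one_mul] at h1
    omega
  set L : ℕ → List (Tr A Unit (Fin d) Q) :=
    fun j => pref (fun k => γ (t j + k)) (t (j + 1) - t j) with hL
  have hblk : ∀ j, (L j).flatMap rd1 = blk x ℓ j := by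
    intro j
    have e1 := flatMap_pref_sub rd1 γ (hmono j)
    have e2 : strm rd1 γ (t j) = pref x (j * ℓ) := by rw [hx.1 (t j), ht]
    have e3 : strm rd1 γ (t (j + 1)) = pref x (j * ℓ + ℓ) := by
      rw [hx.1 (t (j + 1)), ht, add_mul, one_mul]
    rw [e2, e3, pref_add] at e1
    exact List.append_cancel_left e1
  set key : ℕ → Q × Q × List (Fin d) :=
    fun j => ((γ (t j)).1, (γ (t (j + 1))).1, (L j).flatMap wr) with hkey
  have hinj : ∀ i j, key i = key j → blk x ℓ i = blk x ℓ j := by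
    intro i j hij
    simp only [hkey, Prod.mk.injEq] at hij
    obtain ⟨h1, h2, h3⟩ := hij
    rw [← hblk, ← hblk]
    refine hone.injWith.eq_of_path h (hrun.path_sub (hmono i)) ?_
      (fun _ _ => Subsingleton.elim _ _) h3 h3 ?_
    · rw [h1, h2]; exact hrun.path_sub (hmono j)
    · rw [hblk, hblk, blk_length, blk_length]
  refine ⟨((Finset.univ : Finset Q) ×ˢ (Finset.univ : Finset Q) ×ˢ F).image
    fun k => if hk : ∃ j, key j = k then blk x ℓ hk.choose else blk x ℓ 0, ?_, ?_, ?_⟩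
  · refine Finset.card_image_le.trans ?_
    rw [Finset.card_product, Finset.card_product, Finset.card_univ, mul_assoc]
    gcongr
  · intro w hw
    obtain ⟨k, -, rfl⟩ := Finset.mem_image.1 hw
    split_ifs <;> exact blk_length _ _ _
  · intro j hj
    refine Finset.mem_image.2 ⟨key j, ?_, ?_⟩
    · simp only [Finset.mem_product, Finset.mem_univ, true_and]
      refine hFm _ ?_
      have := congrArg List.length (flatMap_pref_sub wr γ (hmono j))
      rw [List.length_append] at this
      simp only [hkey, hL]
      omega
    · have hk : ∃ i, key i = key j := ⟨j, rfl⟩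
      rw [dif_pos hk]
      exact hinj _ _ hk.choose_spec

theorem one_le_liminf_ratio {d : ℕ} (hd : 2 ≤ d) [Fintype A] (hA : 2 ≤ Fintype.card A) [Fintype Q]
    {C : Comp3 A Unit (Fin d) Q} (hdet : C.TwoDet) (hone : C.OneToOne)
    {γ : ℕ → Tr A Unit (Fin d) Q} {x : ℕ → A} (h : C.IsAccRunOn γ x fun _ => ()) (hx : Normal x) :
    1 ≤ liminf (ratio γ) atTop := by
  classical
  obtain ⟨M, hM⟩ := exists_ratio_le hdet h normal_unit
  refine le_of_forall_pos_le_add fun ε hε => ?_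
  rw [← sub_le_iff_le_add]
  refine le_liminf_of_le
    (Filter.isBoundedUnder_of ⟨M, hM⟩ : IsBoundedUnder (· ≤ ·) atTop _).isCoboundedUnder_ge ?_
  set δ := min (ε / 3) (1 / 2) with hδ
  have hδ0 : 0 < δ := by positivity
  have hδ1 : δ ≤ 1 / 2 := min_le_right _ _
  have hδε : δ ≤ ε / 3 := min_le_left _ _
  obtain ⟨ℓ, m, hℓ, hm, hN⟩ := exists_block_params hA hd (Fintype.card Q * Fintype.card Q)
    (show 0 < 1 - δ by linarith) (by linarith) hδ0
  have hS := ((C.isAccRunOn_iff _ _ _).1 h).2.1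
  choose t ht using fun j =>
    exists_length_eq hS.2 (fun n => length_rd1_le (γ n)) (j * ℓ)
  obtain ⟨W, hW, hWl, hWm⟩ := exists_short_blocks (by omega) hone h hℓ m ht
  set bad : ℕ → ℕ := fun n => ((Finset.range n).filter fun j => blk x ℓ j ∈ W).card with hbad
  have hbad1 : ∀ n, bad n ≤ ∑ w ∈ W, blkCount x w n := by
    intro n
    have : (Finset.range n).filter (fun j => blk x ℓ j ∈ W) ⊆
        W.biUnion fun w => (Finset.range n).filter fun j => blk x w.length j = w := by
      intro j hj
      simp only [Finset.mem_filter, Finset.mem_biUnion] at hj ⊢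
      exact ⟨_, hj.2, hj.1, by rw [blk_length]⟩
    exact (Finset.card_le_card this).trans Finset.card_biUnion_le
  have hsum : Tendsto (fun n : ℕ => ∑ w ∈ W, (blkCount x w n : ℝ) / n) atTop
      (𝓝 (∑ w ∈ W, ((Fintype.card A : ℝ)⁻¹) ^ ℓ)) := by
    refine tendsto_finsetSum _ fun w hw => ?_
    have := hx.tendsto_blkCount w (by rw [hWl w hw]; exact hℓ)
    rwa [hWl w hw] at this
  have hlt : ∑ w ∈ W, ((Fintype.card A : ℝ)⁻¹) ^ ℓ < δ := by
    rw [Finset.sum_const, nsmul_eq_mul]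
    refine lt_of_le_of_lt ?_ hN
    exact mul_le_mul_of_nonneg_right (by exact_mod_cast hW) (by positivity)
  have hout : ∀ n, m * n ≤ (strm wr γ (t n)).length + m * bad n := by
    intro n
    induction n with
    | zero => simp
    | succ n ih =>
      have e : bad (n + 1) = bad n + if blk x ℓ n ∈ W then 1 else 0 := by
        simp only [hbad, Finset.range_add_one, Finset.filter_insert]
        split_ifs with hc
        · rw [Finset.card_insert_of_notMem (by simp)]
        · rfl
      have hmono : t n ≤ t (n + 1) := by
        by_contra hlt
        have h1 := strm_length_mono (rd1 : Tr A Unit (Fin d) Q → List A) γ (not_le.1 hlt).le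
        simp only [ht, add_mul, one_mul] at h1
        omega
      have h2 := strm_length_mono (wr : Tr A Unit (Fin d) Q → _) γ hmono
      simp only at h2
      rw [e]
      split_ifs with hc
      · rw [mul_add, mul_add, mul_one]; omega
      · have := mt (hWm n) hc
        rw [mul_add, mul_one, add_zero]; omega
  have htend : Tendsto (fun T => (strm rd1 γ T).length / ℓ - 1) atTop atTop :=
    (tendsto_sub_atTop_nat 1).comp
      ((Nat.tendsto_div_const_atTop (by omega)).comp ((unb_iff _ _).1 hS.2))
  obtain ⟨N, hNN⟩ := exists_nat_gt (2 / δ)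
  filter_upwards [htend.eventually (hsum.eventually (gt_mem_nhds hlt)),
    htend.eventually_ge_atTop (N + 1)] with T h1 h2
  set n := (strm rd1 γ T).length / ℓ - 1 with hn
  have hn0 : (0 : ℝ) < n := by exact_mod_cast (show 0 < n by omega)
  have hnδ : 2 ≤ δ * n := by
    rw [div_lt_iff₀ hδ0] at hNN
    have : (N : ℝ) + 1 ≤ n := by exact_mod_cast h2
    nlinarith
  have hb : (bad n : ℝ) ≤ δ * n := by
    rw [← Finset.sum_div, div_lt_iff₀ hn0] at h1
    have : (bad n : ℝ) ≤ ∑ w ∈ W, (blkCount x w n : ℝ) := by exact_mod_cast hbad1 n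
    linarith
  have hin : (strm rd1 γ T).length < (n + 2) * ℓ := by
    have := Nat.lt_div_mul_add (a := (strm rd1 γ T).length) (b := ℓ) (by omega)
    rw [show (strm rd1 γ T).length / ℓ = n + 1 by omega] at this
    nlinarith
  have hin2 : (n + 1) * ℓ ≤ (strm rd1 γ T).length := by
    have := Nat.div_mul_le_self (strm rd1 γ T).length ℓ
    rwa [show (strm rd1 γ T).length / ℓ = n + 1 by omega] at this
  have htT : t n ≤ T := by
    by_contra hlt
    have h1 := strm_length_mono (rd1 : Tr A Unit (Fin d) Q → List A) γ (not_le.1 hlt).le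
    simp only [ht] at h1
    rw [add_mul, one_mul] at hin2
    omega
  have hout2 : (m : ℝ) * n ≤ (strm wr γ T).length + m * (δ * n) := by
    have h3 := strm_length_mono (wr : Tr A Unit (Fin d) Q → _) γ htT
    simp only at h3
    have h4 : (m : ℝ) * n ≤ (strm wr γ T).length + m * bad n := by
      exact_mod_cast (hout n).trans (Nat.add_le_add_right h3 _)
    have := mul_le_mul_of_nonneg_left hb (Nat.cast_nonneg (α := ℝ) m)
    linarith
  have hlA : 0 < Real.log (Fintype.card A) := Real.log_pos (by exact_mod_cast hA)
  have hld : 0 < Real.log d := Real.log_pos (by exact_mod_cast hd)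
  have hipos : (0 : ℝ) < (strm rd1 γ T).length := by
    exact_mod_cast lt_of_lt_of_le (Nat.mul_pos (by omega) (by omega)) hin2
  have hin' : ((strm rd1 γ T).length : ℝ) ≤ (n + 2) * ℓ := by exact_mod_cast hin.le
  rw [ratio, le_div_iff₀ (by positivity)]
  have hℓ0 : (0 : ℝ) < ℓ := by exact_mod_cast hℓ
  have hε1 : 1 - ε ≤ (1 - δ) * (1 - δ) * (1 - δ) := by nlinarith [mul_pos hδ0 hδ0]
  calc (1 - ε) * ((strm rd1 γ T).length * Real.log (Fintype.card A))
      ≤ ((1 - δ) * (1 - δ) * (1 - δ)) * (((n + 2) * ℓ) * Real.log (Fintype.card A)) := by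
        refine mul_le_mul hε1 (mul_le_mul_of_nonneg_right hin' hlA.le) (by positivity) ?_
        have : 0 ≤ 1 - δ := by linarith
        positivity
    _ = ((1 - δ) * ((1 - δ) * (n + 2))) * ((1 - δ) * ℓ * Real.log (Fintype.card A)) := by ring
    _ ≤ ((1 - δ) * n) * (m * Real.log d) := by
        have : 0 ≤ 1 - δ := by linarith
        refine mul_le_mul (mul_le_mul_of_nonneg_left ?_ this) hm (by positivity) (by positivity)
        nlinarith
    _ = (m * n - m * (δ * n)) * Real.log d := by ring
    _ ≤ (strm wr γ T).length * Real.log d :=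
        mul_le_mul_of_nonneg_right (by linarith) hld.le

theorem Normal.one_le_rho [Fintype A] (hA : 2 ≤ Fintype.card A) {x : ℕ → A} (hx : Normal x) :
    1 ≤ rho x := by
  rw [rho_eq]
  refine le_csInf ⟨1, one_mem_ratioSet hA x⟩ ?_
  rintro r ⟨m, d, hd, C, h1, h2, γ, h3, rfl⟩
  have := one_le_liminf_ratio hd hA (h1.lift (B := Unit)) h2.lift (h3.lift fun _ => ()) hx
  refine this.trans_eq (congrArg (liminf · atTop) ?_)
  funext n
  rw [ratio, strm_wr_liftRun, strm_rd1_liftRun]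

theorem two_le_card_of_rho_pos [Fintype A] {x : ℕ → A} (h : 0 < rho x) : 2 ≤ Fintype.card A := by
  by_contra hcon
  have hlog : Real.log (Fintype.card A) = 0 := by
    have : Fintype.card A = 0 ∨ Fintype.card A = 1 := by omega
    rcases this with h | h <;> simp [h]
  have hsub : ratioSet x ⊆ {0} := by
    rintro r ⟨m, d, -, C, -, -, γ, -, rfl⟩
    simp [hlog]
  rw [rho_eq] at h
  rcases Set.subset_singleton_iff_eq.1 hsub with h0 | h0 <;> simp [h0] at h

theorem strm_nth {τ τ' E : Type*} {P : ℕ → Prop} [DecidablePred P] {f : τ → List E}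
    {f' : τ' → List E} (g : τ → τ') {γ : ℕ → τ} (h1 : ∀ n, ¬ P n → f (γ n) = [])
    (h2 : ∀ n, P n → f (γ n) = f' (g (γ n))) (n : ℕ) :
    strm f γ n = strm f' (fun j => g (γ (Nat.nth P j))) (Nat.count P n) := by
  induction n with
  | zero => rw [Nat.count_zero]; rfl
  | succ n ih =>
    rw [Nat.count_succ, strm_succ, ih]
    by_cases hn : P n
    · rw [if_pos hn, strm_succ, h2 n hn]
      simp only [Nat.nth_count hn]
    · rw [if_neg hn, h1 n hn, List.append_nil, add_zero]

theorem strm_eq_nth {τ τ' E : Type*} {P : ℕ → Prop} [DecidablePred P] {f : τ → List E}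
    {f' : τ' → List E} {γ : ℕ → τ} {γ' : ℕ → τ'} (hP : (Set.ofPred P).Infinite)
    (h : ∀ n, strm f γ n = strm f' γ' (Nat.count P n)) (j : ℕ) :
    strm f' γ' j = strm f γ (Nat.nth P j) := by
  rw [h, Nat.count_nth_of_infinite hP]

theorem SubStream.trans {τ τ' τ'' E : Type*} {f : τ → List E} {f' : τ' → List E}
    {f'' : τ'' → List E} {γ : ℕ → τ} {γ' : ℕ → τ'} {γ'' : ℕ → τ''} (h1 : SubStream f γ f' γ')
    (h2 : SubStream f' γ' f'' γ'') : SubStream f γ f'' γ'' := by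
  intro n
  obtain ⟨m, hm⟩ := h1 n
  obtain ⟨k, hk⟩ := h2 m
  exact ⟨k, hm.trans hk⟩

/-! ### Running a transducer on a selected word -/

theorem unb_of_forall_exists {τ α : Type*} {f : τ → List α} {γ : ℕ → τ}
    (h : ∀ n, ∃ m, n ≤ m ∧ f (γ m) ≠ []) : Unb f γ := by
  intro N
  induction N with
  | zero => exact ⟨0, Nat.zero_le _⟩
  | succ N ih =>
    obtain ⟨n, hn⟩ := ih
    obtain ⟨m, hm, hne⟩ := h n
    have h1 := strm_length_mono f γ hm
    have h2 := List.length_pos_iff.2 hne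
    refine ⟨m + 1, ?_⟩
    rw [strm_succ, List.length_append]
    simp only at h1
    omega

/-- The symbols skipped by the selector among the first `n` symbols of `y`. -/
def Sel1.skipList (S : Sel1 B) (y : ℕ → B) (n : ℕ) : List B :=
  (List.range n).filterMap fun i => if S.sel (S.st y i) then none else some (y i)

theorem Sel1.outList_succ (S : Sel1 B) (y : ℕ → B) (n : ℕ) :
    S.outList y (n + 1) = S.outList y n ++ if S.sel (S.st y n) then [y n] else [] := by
  rw [Sel1.outList, List.range_succ, List.filterMap_append, Sel1.outList]
  congr 1
  by_cases h : S.sel (S.st y n) <;> simp [h]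

theorem Sel1.skipList_succ (S : Sel1 B) (y : ℕ → B) (n : ℕ) :
    S.skipList y (n + 1) = S.skipList y n ++ if S.sel (S.st y n) then [] else [y n] := by
  rw [Sel1.skipList, List.range_succ, List.filterMap_append, Sel1.skipList]
  congr 1
  by_cases h : S.sel (S.st y n) <;> simp [h]

theorem Sel1.outList_mono (S : Sel1 B) (y : ℕ → B) : Monotone fun n => (S.outList y n).length :=
  monotone_nat_of_le_succ fun n => by rw [S.outList_succ, List.length_append]; omega

theorem Sel1.length_outList_le (S : Sel1 B) (y : ℕ → B) (n : ℕ) : (S.outList y n).length ≤ n :=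
  (List.length_filterMap_le _ _).trans (by simp)

section SelComp

variable {S : Sel1 B} {C : Comp3 B A D Q}

/-- The transition skips a symbol of the first tape. -/
def Sel1.skips (S : Sel1 B) (t : Tr B A D (Q × Fin S.states)) : Bool :=
  !S.sel t.1.2 && t.2.1.1.isSome

/-- Forgetting the state of the selector. -/
def Tr.proj {R : Type*} (t : Tr B A D (Q × R)) : Tr B A D Q := (t.1.1, t.2.1, t.2.2.1, t.2.2.2.1)

/-- The transducer that applies the selector to its first input and behaves as `C` on the
selected word. -/
def selComp (S : Sel1 B) (C : Comp3 B A D Q) : Comp3 B A D (Q × Fin S.states) where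
  init := (C.init, S.init)
  trans := {t | t.2.2.2.2 = t.2.1.1.elim t.1.2 (S.δ t.1.2) ∧
    if S.skips t then t.2.2.2.1 = t.1.1 ∧ t.2.1.2 = none ∧ t.2.2.1 = [] ∧
      ∃ τ ∈ C.trans, τ.1 = t.1.1 ∧ τ.2.1.1.isSome
    else Tr.proj t ∈ C.trans}

/-- What the selector selects when a transition is taken. -/
def Sel1.slc (S : Sel1 B) (t : Tr B A D (Q × Fin S.states)) : List B :=
  if S.skips t then [] else rd1 t

/-- What the selector skips when a transition is taken. -/
def Sel1.skp (S : Sel1 B) (t : Tr B A D (Q × Fin S.states)) : List B :=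
  if S.skips t then rd1 t else []

theorem Comp3.TwoDet.selComp (h : C.TwoDet) : (selComp S C).TwoDet := by
  rintro t ⟨h1, h2⟩ t' ⟨h1', h2'⟩ he
  have hmix : ∀ {u u' : Tr B A D (Q × Fin S.states)}, u.1 = u'.1 → S.skips u = true →
      S.skips u' = false → (∃ τ ∈ C.trans, τ.1 = u.1.1 ∧ τ.2.1.1.isSome) →
      Tr.proj u' ∈ C.trans → False := by
    rintro u u' he hu hu' ⟨τ, hτ, e, hs⟩ hm
    have := (h τ hτ _ hm (e.trans (congrArg Prod.fst he))).1
    simp only [lsupp, Tr.proj, Prod.mk.injEq, hs] at this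
    simp only [Sel1.skips, Bool.and_eq_true, Bool.and_eq_false_iff, he] at hu hu'
    rw [hu.1, ← this.1] at hu'
    simp at hu'
  by_cases hs : S.skips t <;> by_cases hs' : S.skips t' <;>
    simp only [hs, hs', if_true, if_false, Bool.false_eq_true] at h2 h2'
  · have r1 : t.2.1.1.isSome := by simp only [Sel1.skips, Bool.and_eq_true] at hs; exact hs.2
    have r2 : t'.2.1.1.isSome := by simp only [Sel1.skips, Bool.and_eq_true] at hs'; exact hs'.2
    refine ⟨by rw [lsupp, lsupp, r1, r2, h2.2.1, h2'.2.1], fun hl => ?_⟩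
    refine Prod.ext he (Prod.ext hl (Prod.ext (h2.2.2.1.trans h2'.2.2.1.symm) (Prod.ext ?_ ?_)))
    · rw [h2.1, h2'.1, he]
    · rw [h1, h1', he, hl]
  · exact (hmix he hs (by simpa using hs') h2.2.2.2 h2').elim
  · exact (hmix he.symm hs' (by simpa using hs) h2'.2.2.2 h2).elim
  · obtain ⟨d1, d2⟩ := h _ h2 _ h2' (congrArg (fun p : Q × Fin S.states => p.1) he)
    refine ⟨d1, fun hl => ?_⟩
    have hp := d2 hl
    simp only [Tr.proj, Prod.mk.injEq] at hp
    exact Prod.ext he (Prod.ext hl (Prod.ext hp.2.2.1 (Prod.ext hp.2.2.2 (by rw [h1, h1', he, hl]))))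

section Extract

variable {γ : ℕ → Tr B A D (Q × Fin S.states)} {y : ℕ → B} {x : ℕ → A}

theorem selComp_state (h : (selComp S C).IsAccRunOn γ y x) (n : ℕ) :
    (γ n).1.2 = S.st y (strm rd1 γ n).length := by
  rw [Comp3.isAccRunOn_iff] at h
  obtain ⟨h1, h2, -, -⟩ := h
  induction n with
  | zero => rw [h1.start]; rfl
  | succ n ih =>
    rw [← h1.chain, (h1.mem n).1, strm_succ, List.length_append]
    cases hb : (γ n).2.1.1 with
    | none => simp [rd1, hb, ih]
    | some b => simp [rd1, hb, ih, h2.head_rd1 n hb, Sel1.st]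

theorem strm_slc (h : (selComp S C).IsAccRunOn γ y x) (n : ℕ) :
    strm S.slc γ n = S.outList y (strm rd1 γ n).length := by
  have hst := selComp_state h
  rw [Comp3.isAccRunOn_iff] at h
  obtain ⟨h1, h2, -, -⟩ := h
  induction n with
  | zero => rfl
  | succ n ih =>
    rw [strm_succ, ih, strm_succ, List.length_append]
    cases hb : (γ n).2.1.1 with
    | none => simp [Sel1.slc, rd1, hb]
    | some b =>
      have : (rd1 (γ n)).length = 1 := by simp [rd1, hb]
      rw [this, S.outList_succ, ← hst, ← h2.head_rd1 n hb]
      by_cases hs : S.sel (γ n).1.2 <;> simp [Sel1.slc, Sel1.skips, rd1, hb, hs]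

theorem strm_skp (h : (selComp S C).IsAccRunOn γ y x) (n : ℕ) :
    strm S.skp γ n = S.skipList y (strm rd1 γ n).length := by
  have hst := selComp_state h
  rw [Comp3.isAccRunOn_iff] at h
  obtain ⟨h1, h2, -, -⟩ := h
  induction n with
  | zero => rfl
  | succ n ih =>
    rw [strm_succ, ih, strm_succ, List.length_append]
    cases hb : (γ n).2.1.1 with
    | none => simp [Sel1.skp, Sel1.skips, rd1, hb]
    | some b =>
      have : (rd1 (γ n)).length = 1 := by simp [rd1, hb]
      rw [this, S.skipList_succ, ← hst, ← h2.head_rd1 n hb]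
      by_cases hs : S.sel (γ n).1.2 <;> simp [Sel1.skp, Sel1.skips, rd1, hb, hs]

theorem Comp3.IsAccRunOn.extract (hdet : C.TwoDet) (h : (selComp S C).IsAccRunOn γ y x) :
    ∃ y' γ', C.IsAccRunOn γ' y' x ∧ SubStream wr γ wr γ' ∧ SubStream wr γ' wr γ ∧
      (∀ k, Begins (S.outList y k) y') ∧ ∀ N, ∃ k, N ≤ (S.outList y k).length := by
  classical
  have hslc := strm_slc h
  rw [Comp3.isAccRunOn_iff] at h
  obtain ⟨h1, h2, h3, h4⟩ := h
  set P : ℕ → Prop := fun n => S.skips (γ n) = false with hP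
  have hskip : ∀ n, ¬ P n → (γ n).2.2.2.1 = (γ n).1.1 ∧ (γ n).2.1.2 = none ∧ (γ n).2.2.1 = [] ∧
      ∃ τ ∈ C.trans, τ.1 = (γ n).1.1 ∧ τ.2.1.1.isSome := by
    intro n hn
    have := (h1.mem n).2
    rwa [if_pos (by simpa [hP] using hn)] at this
  have hact : ∀ n, P n → Tr.proj (γ n) ∈ C.trans := by
    intro n hn
    have := (h1.mem n).2
    rwa [if_neg (by simpa [hP] using hn)] at this
  have hinf : (Set.ofPred P).Infinite := by
    refine Set.infinite_of_forall_exists_gt fun n => ?_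
    obtain ⟨m, hm, hne⟩ := exists_nonempty_ge h4 (n + 1)
    exact ⟨m, by_contra fun hc => hne (hskip m hc).2.2.1, hm⟩
  set γ' : ℕ → Tr B A D Q := fun j => Tr.proj (γ (Nat.nth P j)) with hγ'
  have hstate : ∀ k n, Nat.nth P (Nat.count P n) = n + k →
      (γ n).1.1 = (γ (Nat.nth P (Nat.count P n))).1.1 := by
    intro k
    induction k with
    | zero => intro n hn; rw [hn, add_zero]
    | succ k ih =>
      intro n hn
      have hPn : ¬ P n := fun hc => by rw [Nat.nth_count hc] at hn; omega
      have hc : Nat.count P (n + 1) = Nat.count P n := by rw [Nat.count_succ, if_neg hPn, add_zero]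
      have := ih (n + 1) (by rw [hc, hn]; omega)
      rw [hc, ← h1.chain, (hskip n hPn).1] at this
      exact this
  have hstate' : ∀ n, (γ n).1.1 = (γ (Nat.nth P (Nat.count P n))).1.1 := fun n =>
    hstate _ n (Nat.add_sub_of_le (Nat.le_nth_count hinf n)).symm
  have hPnth : ∀ j, P (Nat.nth P j) := fun j => Nat.nth_mem_of_infinite hinf j
  have hrun : IsRun C.trans C.init γ' := by
    refine ⟨?_, fun j => hact _ (hPnth j), fun j => ?_⟩
    · have := hstate' 0
      rw [Nat.count_zero, h1.start] at this
      exact this.symm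
    · have := hstate' (Nat.nth P j + 1)
      rw [Nat.count_succ, if_pos (hPnth j), Nat.count_nth_of_infinite hinf, ← h1.chain] at this
      exact this
  have hwr : ∀ n, strm wr γ n = strm wr γ' (Nat.count P n) :=
    strm_nth Tr.proj (fun n hn => (hskip n hn).2.2.1) fun n _ => rfl
  have hrd2 : ∀ n, strm rd2 γ n = strm rd2 γ' (Nat.count P n) := strm_nth Tr.proj
    (fun n hn => by simp [rd2, (hskip n hn).2.1]) fun n _ => rfl
  have hrd1 : ∀ n, strm S.slc γ n = strm rd1 γ' (Nat.count P n) := strm_nth Tr.proj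
    (fun n hn => by rw [Sel1.slc, if_pos (by simpa [hP] using hn)])
    (fun n hn => by rw [Sel1.slc, if_neg (by simpa [hP] using hn)]; rfl)
  have hslcu : Unb S.slc γ := by
    refine unb_of_forall_exists fun n => ?_
    obtain ⟨m, hm, hne⟩ := exists_nonempty_ge h2.2 n
    by_cases hPm : P m
    · exact ⟨m, hm, by rwa [Sel1.slc, if_neg (by simpa [hP] using hPm)]⟩
    · refine ⟨Nat.nth P (Nat.count P m), hm.trans (Nat.le_nth_count hinf m), ?_⟩
      rw [Sel1.slc, if_neg (by simpa [hP] using hPnth (Nat.count P m)), rd1_ne_nil]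
      obtain ⟨τ, hτ, e, hs⟩ := (hskip m hPm).2.2.2
      have := (hdet τ hτ _ (hact _ (hPnth (Nat.count P m))) (e.trans (hstate' m))).1
      simp only [lsupp, Prod.mk.injEq, hs] at this
      exact this.1.symm
  have hu1 : Unb rd1 γ' := fun N => by
    obtain ⟨n, hn⟩ := hslcu N
    exact ⟨_, by rwa [hrd1 n] at hn⟩
  obtain ⟨y', hy'⟩ := exists_word (strm rd1 γ') (fun n => strm_mono rd1 γ' (Nat.le_succ n)) hu1
  refine ⟨y', γ', ?_, fun n => ⟨_, by rw [hwr n]⟩, fun n => ⟨_, by rw [strm_eq_nth hinf hwr n]⟩, fun k => ?_,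
    fun N => ?_⟩
  · rw [Comp3.isAccRunOn_iff]
    refine ⟨hrun, ⟨hy', hu1⟩, ⟨fun j => ?_, fun N => ?_⟩, fun N => ?_⟩
    · rw [strm_eq_nth hinf hrd2]; exact h3.1 _
    · obtain ⟨n, hn⟩ := h3.2 N
      exact ⟨_, by rwa [hrd2 n] at hn⟩
    · obtain ⟨n, hn⟩ := h4 N
      exact ⟨_, by rwa [hwr n] at hn⟩
  · obtain ⟨n, rfl⟩ := exists_length_eq h2.2 (fun n => length_rd1_le (γ n)) k
    rw [← hslc, hrd1]
    exact hy' _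
  · obtain ⟨n, hn⟩ := hslcu N
    exact ⟨_, by rwa [hslc n] at hn⟩

end Extract

theorem Comp3.OneToOne.selComp_injWith (hdet : C.TwoDet) (hone : C.OneToOne) :
    (selComp S C).InjWith S.skp := by
  intro y₁ y₂ x γ₁ γ₂ h₁ h₂ w₁ w₂ s₁ s₂
  obtain ⟨z₁, δ₁, hδ₁, a₁, b₁, c₁, -⟩ := h₁.extract hdet
  obtain ⟨z₂, δ₂, hδ₂, a₂, b₂, c₂, -⟩ := h₂.extract hdet
  have hz : z₁ = z₂ := C.oneToOne_iff.1 hone z₁ z₂ x δ₁ δ₂ hδ₁ hδ₂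
    (b₁.trans (w₁.trans a₂)) (b₂.trans (w₂.trans a₁))
  subst hz
  have hskip : ∀ n, ∃ l, S.skipList y₁ n <+: l ∧ S.skipList y₂ n <+: l := by
    intro n
    have r₁ := ((selComp S C).isAccRunOn_iff _ _ _).1 h₁
    have r₂ := ((selComp S C).isAccRunOn_iff _ _ _).1 h₂
    obtain ⟨n₁, e₁⟩ := exists_length_eq r₁.2.1.2 (fun n => length_rd1_le (γ₁ n)) n
    obtain ⟨n₂, e₂⟩ := exists_length_eq r₂.2.1.2 (fun n => length_rd1_le (γ₂ n)) n
    have k₁ := strm_skp h₁ n₁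
    have k₂ := strm_skp h₂ n₂
    rw [e₁] at k₁
    rw [e₂] at k₂
    obtain ⟨m, hm⟩ := s₁ n₁
    refine ⟨strm S.skp γ₂ (max m n₂), ?_, ?_⟩
    · rw [← k₁]; exact hm.trans (strm_mono _ _ (le_max_left _ _))
    · rw [← k₂]; exact strm_mono _ _ (le_max_right _ _)
  have hst : ∀ n, (∀ i < n, y₁ i = y₂ i) → S.st y₁ n = S.st y₂ n ∧
      S.outList y₁ n = S.outList y₂ n ∧ S.skipList y₁ n = S.skipList y₂ n := by
    intro n
    induction n with
    | zero => intro _; exact ⟨rfl, rfl, rfl⟩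
    | succ n ih =>
      intro hn
      obtain ⟨i1, i2, i3⟩ := ih fun i hi => hn i (by omega)
      refine ⟨?_, ?_, ?_⟩
      · rw [Sel1.st, Sel1.st, i1, hn n (Nat.lt_succ_self n)]
      · rw [S.outList_succ, S.outList_succ, i1, i2, hn n (Nat.lt_succ_self n)]
      · rw [S.skipList_succ, S.skipList_succ, i1, i3, hn n (Nat.lt_succ_self n)]
  funext n
  induction n using Nat.strong_induction_on with
  | _ n ih =>
    obtain ⟨i1, i2, i3⟩ := hst n ih
    by_cases hs : S.sel (S.st y₁ n)
    · have g₁ := c₁ (n + 1)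
      have g₂ := c₂ (n + 1)
      rw [S.outList_succ, if_pos hs] at g₁
      rw [S.outList_succ, if_pos (i1 ▸ hs)] at g₂
      rw [g₁.append_singleton, g₂.append_singleton, i2]
    · obtain ⟨l, g₁, g₂⟩ := hskip (n + 1)
      rw [S.skipList_succ, if_neg hs] at g₁
      rw [S.skipList_succ, if_neg (i1 ▸ hs), ← i3] at g₂
      have := (List.prefix_of_prefix_length_le g₁ g₂ (by simp)).eq_of_length (by simp)
      simpa using this

end SelComp

section Forward

variable {S : Sel1 B} {C : Comp3 B A D Q}

/-- The numbers of transitions of `γ'` and of symbols of `y` used after `n` transitions of the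
composition of the selector with `γ'`. -/
def Sel1.cfg (S : Sel1 B) (γ' : ℕ → Tr B A D Q) (y : ℕ → B) : ℕ → ℕ × ℕ
  | 0 => (0, 0)
  | n + 1 =>
    let c := S.cfg γ' y n
    if (γ' c.1).2.1.1.isSome then
      if S.sel (S.st y c.2) then (c.1 + 1, c.2 + 1) else (c.1, c.2 + 1)
    else (c.1 + 1, c.2)

/-- The composition of the selector with the run `γ'`. -/
def Sel1.feed (S : Sel1 B) (γ' : ℕ → Tr B A D Q) (y : ℕ → B) (n : ℕ) :
    Tr B A D (Q × Fin S.states) :=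
  let c := S.cfg γ' y n
  let s := S.st y c.2
  let t := γ' c.1
  if t.2.1.1.isSome then
    if S.sel s then ((t.1, s), t.2.1, t.2.2.1, (t.2.2.2, S.st y (c.2 + 1)))
    else ((t.1, s), (some (y c.2), none), [], (t.1, S.st y (c.2 + 1)))
  else ((t.1, s), t.2.1, t.2.2.1, (t.2.2.2, s))

theorem Sel1.step_cases (S : Sel1 B) (γ' : ℕ → Tr B A D Q) (y : ℕ → B) (n : ℕ) :
    ((γ' (S.cfg γ' y n).1).2.1.1 = none ∧
      S.cfg γ' y (n + 1) = ((S.cfg γ' y n).1 + 1, (S.cfg γ' y n).2) ∧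
      S.feed γ' y n = (((γ' (S.cfg γ' y n).1).1, S.st y (S.cfg γ' y n).2),
        (γ' (S.cfg γ' y n).1).2.1, (γ' (S.cfg γ' y n).1).2.2.1,
        ((γ' (S.cfg γ' y n).1).2.2.2, S.st y (S.cfg γ' y n).2))) ∨
    (∃ b, (γ' (S.cfg γ' y n).1).2.1.1 = some b ∧ S.sel (S.st y (S.cfg γ' y n).2) = true ∧
      S.cfg γ' y (n + 1) = ((S.cfg γ' y n).1 + 1, (S.cfg γ' y n).2 + 1) ∧
      S.feed γ' y n = (((γ' (S.cfg γ' y n).1).1, S.st y (S.cfg γ' y n).2),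
        (γ' (S.cfg γ' y n).1).2.1, (γ' (S.cfg γ' y n).1).2.2.1,
        ((γ' (S.cfg γ' y n).1).2.2.2, S.st y ((S.cfg γ' y n).2 + 1)))) ∨
    (∃ b, (γ' (S.cfg γ' y n).1).2.1.1 = some b ∧ S.sel (S.st y (S.cfg γ' y n).2) = false ∧
      S.cfg γ' y (n + 1) = ((S.cfg γ' y n).1, (S.cfg γ' y n).2 + 1) ∧
      S.feed γ' y n = (((γ' (S.cfg γ' y n).1).1, S.st y (S.cfg γ' y n).2),
        (some (y (S.cfg γ' y n).2), none), [],
        ((γ' (S.cfg γ' y n).1).1, S.st y ((S.cfg γ' y n).2 + 1)))) := by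
  rw [Sel1.cfg, Sel1.feed]
  generalize S.cfg γ' y n = c
  cases hb : (γ' c.1).2.1.1 with
  | none => left; simp
  | some b =>
    right
    cases hs : S.sel (S.st y c.2) with
    | true => left; simp
    | false => right; simp

variable {γ' : ℕ → Tr B A D Q} {y y' : ℕ → B} {x : ℕ → A}

theorem Sel1.feed_inv (h : Spells rd1 γ' y') (hy' : ∀ n, Begins (S.outList y n) y') (n : ℕ) :
    strm rd1 (S.feed γ' y) n = pref y (S.cfg γ' y n).2 ∧
    strm wr (S.feed γ' y) n = strm wr γ' (S.cfg γ' y n).1 ∧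
    strm rd2 (S.feed γ' y) n = strm rd2 γ' (S.cfg γ' y n).1 ∧
    (S.outList y (S.cfg γ' y n).2).length = (strm rd1 γ' (S.cfg γ' y n).1).length ∧
    ((γ' (S.cfg γ' y n).1).2.1.1.isSome → S.sel (S.st y (S.cfg γ' y n).2) = true →
      (γ' (S.cfg γ' y n).1).2.1.1 = some (y (S.cfg γ' y n).2)) := by
  have hhead : ∀ j k, (S.outList y k).length = (strm rd1 γ' j).length →
      (γ' j).2.1.1.isSome → S.sel (S.st y k) = true → (γ' j).2.1.1 = some (y k) := by
    intro j k e hj hs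
    obtain ⟨b, hb⟩ := Option.isSome_iff_exists.1 hj
    have h1 := hy' (k + 1)
    rw [S.outList_succ, if_pos hs] at h1
    rw [hb, h.head_rd1 j hb, ← e, h1.append_singleton]
  suffices H : strm rd1 (S.feed γ' y) n = pref y (S.cfg γ' y n).2 ∧
      strm wr (S.feed γ' y) n = strm wr γ' (S.cfg γ' y n).1 ∧
      strm rd2 (S.feed γ' y) n = strm rd2 γ' (S.cfg γ' y n).1 ∧
      (S.outList y (S.cfg γ' y n).2).length = (strm rd1 γ' (S.cfg γ' y n).1).length from
    ⟨H.1, H.2.1, H.2.2.1, H.2.2.2, hhead _ _ H.2.2.2⟩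
  induction n with
  | zero => exact ⟨rfl, rfl, rfl, rfl⟩
  | succ n ih =>
    obtain ⟨i1, i2, i3, i4⟩ := ih
    rw [strm_succ, strm_succ, strm_succ, i1, i2, i3]
    rcases S.step_cases γ' y n with ⟨e1, e2, e3⟩ | ⟨b, e1, e0, e2, e3⟩ | ⟨b, e1, e0, e2, e3⟩
    · rw [e2, e3]
      simp only [strm_succ]
      refine ⟨by simp [rd1, e1], rfl, rfl, by simp [i4, rd1, e1]⟩
    · rw [e2, e3]
      simp only [strm_succ, pref_succ]
      have := hhead _ _ i4 (by simp [e1]) e0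
      refine ⟨by simp [rd1, this], rfl, rfl, ?_⟩
      rw [S.outList_succ, if_pos e0, List.length_append, List.length_append, i4]
      simp [rd1, e1]
    · rw [e2, e3]
      simp only [pref_succ]
      refine ⟨by simp [rd1], by simp [wr], by simp [rd2], ?_⟩
      rw [S.outList_succ, if_neg (by simp [e0])]
      simpa using i4

theorem Sel1.cfg_monotone : Monotone fun n => (S.cfg γ' y n).1 := by
  refine monotone_nat_of_le_succ fun n => ?_
  rcases S.step_cases γ' y n with ⟨-, e, -⟩ | ⟨b, -, -, e, -⟩ | ⟨b, -, -, e, -⟩ <;> simp [e]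

theorem Sel1.cfg_surjective (h : Spells rd1 γ' y') (hy' : ∀ n, Begins (S.outList y n) y')
    (hinf : ∀ N, ∃ n, N ≤ (S.outList y n).length) :
    Function.Surjective fun n => (S.cfg γ' y n).1 := by
  intro N
  induction N with
  | zero => exact ⟨0, rfl⟩
  | succ N ih =>
    obtain ⟨n, hn⟩ := ih
    by_contra hcon
    push Not at hcon
    have hstuck : ∀ i, (S.cfg γ' y (n + i)).1 = N ∧ (S.cfg γ' y (n + i)).2 = (S.cfg γ' y n).2 + i := by
      intro i
      induction i with
      | zero => exact ⟨hn, rfl⟩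
      | succ i ih =>
        have hc := hcon (n + (i + 1))
        rcases S.step_cases γ' y (n + i) with ⟨-, e, -⟩ | ⟨b, -, -, e, -⟩ | ⟨b, -, -, e, -⟩
        · rw [← add_assoc, e] at hc; exact absurd (by simp [ih.1]) hc
        · rw [← add_assoc, e] at hc; exact absurd (by simp [ih.1]) hc
        · rw [← add_assoc, e, ih.2]; exact ⟨ih.1, by simp [add_assoc]⟩
    obtain ⟨m, hm⟩ := hinf ((strm rd1 γ' N).length + 1)
    have h1 := (Sel1.feed_inv h hy' (n + m)).2.2.2.1
    rw [(hstuck m).1, (hstuck m).2] at h1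
    have h2 := S.outList_mono y (show m ≤ (S.cfg γ' y n).2 + m by omega)
    simp only at h2
    omega

theorem Comp3.IsAccRunOn.feed (h : C.IsAccRunOn γ' y' x) (hy' : ∀ n, Begins (S.outList y n) y')
    (hinf : ∀ N, ∃ n, N ≤ (S.outList y n).length) :
    (selComp S C).IsAccRunOn (S.feed γ' y) y x := by
  rw [Comp3.isAccRunOn_iff] at h ⊢
  obtain ⟨h1, h2, h3, h4⟩ := h
  have hinv := Sel1.feed_inv h2 hy'
  have hsurj := Sel1.cfg_surjective h2 hy' hinf
  have hu : ∀ N, ∃ n, N ≤ (S.cfg γ' y n).2 := by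
    intro N
    obtain ⟨m, hm⟩ := h2.2 N
    obtain ⟨n, rfl⟩ := hsurj m
    refine ⟨n, hm.trans ?_⟩
    rw [← (hinv n).2.2.2.1]
    exact S.length_outList_le y _
  have hst : ∀ n, (S.feed γ' y n).1 = ((γ' (S.cfg γ' y n).1).1, S.st y (S.cfg γ' y n).2) := by
    intro n
    rcases S.step_cases γ' y n with ⟨-, -, e⟩ | ⟨b, -, -, -, e⟩ | ⟨b, -, -, -, e⟩ <;> rw [e]
  refine ⟨⟨?_, fun n => ?_, fun n => ?_⟩, ⟨fun n => ?_, fun N => ?_⟩, ⟨fun n => ?_, fun N => ?_⟩,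
    fun N => ?_⟩
  · rw [hst, Sel1.cfg, h1.start]; rfl
  · have hsel := (hinv n).2.2.2.2
    have hmem := h1.mem (S.cfg γ' y n).1
    rcases S.step_cases γ' y n with ⟨e1, -, e⟩ | ⟨b, e1, e0, -, e⟩ | ⟨b, e1, e0, -, e⟩
    · rw [e]
      refine ⟨by simp [e1], ?_⟩
      rw [if_neg (by simp [Sel1.skips, e1])]
      exact hmem
    · rw [e]
      refine ⟨by simp [hsel (by simp [e1]) e0, Sel1.st], ?_⟩
      rw [if_neg (by simp [Sel1.skips, e0])]
      exact hmem
    · rw [e]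
      refine ⟨by simp [Sel1.st], ?_⟩
      rw [if_pos (by simp [Sel1.skips, e0])]
      exact ⟨rfl, rfl, rfl, _, hmem, rfl, by simp [e1]⟩
  · rw [hst (n + 1)]
    rcases S.step_cases γ' y n with ⟨-, e2, e⟩ | ⟨b, -, -, e2, e⟩ | ⟨b, -, -, e2, e⟩ <;>
      rw [e, e2] <;> simp [h1.chain]
  · rw [(hinv n).1]; exact begins_pref y _
  · obtain ⟨n, hn⟩ := hu N
    exact ⟨n, by rwa [(hinv n).1, pref_length]⟩
  · rw [(hinv n).2.2.1]; exact h3.1 _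
  · obtain ⟨m, hm⟩ := h3.2 N
    obtain ⟨n, rfl⟩ := hsurj m
    exact ⟨n, by rwa [(hinv n).2.2.1]⟩
  · obtain ⟨m, hm⟩ := h4 N
    obtain ⟨n, rfl⟩ := hsurj m
    exact ⟨n, by rwa [(hinv n).2.1]⟩

end Forward

/-! ### Exchanging the input tapes -/

/-- Exchange of the two input tapes of a transition. -/
def Tr.swap (t : Tr A B D Q) : Tr B A D Q := (t.1, t.2.1.swap, t.2.2.1, t.2.2.2)

/-- Exchange of the two input tapes of a transducer. -/
def Comp3.swap (C : Comp3 A B D Q) : Comp3 B A D Q := ⟨C.init, {t | Tr.swap t ∈ C.trans}⟩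

theorem Comp3.TwoDet.swap {C : Comp3 A B D Q} (h : C.TwoDet) : C.swap.TwoDet := by
  intro t ht t' ht' he
  obtain ⟨h1, h2⟩ := h _ ht _ ht' he
  refine ⟨by simpa [lsupp, Tr.swap, and_comm] using h1, fun hl => ?_⟩
  have := h2 (by rw [Tr.swap, Tr.swap, hl])
  exact congrArg Tr.swap this

theorem strm_swap {E : Type*} (f : Tr B A D Q → List E) (γ : ℕ → Tr A B D Q) (n : ℕ) :
    strm f (fun i => (γ i).swap) n = strm (fun t => f t.swap) γ n := by
  induction n with
  | zero => rfl
  | succ n ih => rw [strm_succ, strm_succ, ih]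

theorem Comp3.IsAccRunOn.swap {C : Comp3 A B D Q} {γ : ℕ → Tr A B D Q} {x : ℕ → A} {y : ℕ → B}
    (h : C.IsAccRunOn γ x y) : C.swap.IsAccRunOn (fun i => (γ i).swap) y x := by
  rw [Comp3.isAccRunOn_iff] at h ⊢
  obtain ⟨h1, h2, h3, h4⟩ := h
  refine ⟨⟨h1.start, h1.mem, h1.chain⟩, ⟨fun n => ?_, fun N => ?_⟩, ⟨fun n => ?_, fun N => ?_⟩,
    fun N => ?_⟩
  · rw [strm_swap]; exact h3.1 n
  · obtain ⟨n, hn⟩ := h3.2 N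
    exact ⟨n, by rw [strm_swap]; exact hn⟩
  · rw [strm_swap]; exact h2.1 n
  · obtain ⟨n, hn⟩ := h2.2 N
    exact ⟨n, by rw [strm_swap]; exact hn⟩
  · obtain ⟨n, hn⟩ := h4 N
    exact ⟨n, by rw [strm_swap]; exact hn⟩

theorem subStream_wr_swap {γ γ' : ℕ → Tr A B D Q} (h : SubStream wr γ wr γ') :
    SubStream wr (fun i => (γ i).swap) wr (fun i => (γ' i).swap) := by
  intro n
  obtain ⟨m, hm⟩ := h n
  refine ⟨m, ?_⟩
  rw [strm_swap, strm_swap]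
  exact hm

theorem condSet_subset_of_selection [Fintype A] [Fintype B] {x : ℕ → A} {y y' : ℕ → B} {S : Sel1 B}
    (hy' : ∀ n, Begins (S.outList y n) y') (hinf : ∀ N, ∃ n, N ≤ (S.outList y n).length) :
    condSet x y' ⊆ condSet x y := by
  rintro r ⟨m, d, hd, C, hdet, hone, γ', hγ', rfl⟩
  set M := (selComp S C.swap).swap with hM
  have hdetM : M.TwoDet := hdet.swap.selComp.swap
  have honeM : M.OneToOne := by
    rw [Comp3.oneToOne_iff]
    intro x₁ x₂ z γ₁ γ₂ h₁ h₂ w₁ w₂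
    obtain ⟨z₁, δ₁, r₁, a₁, b₁, c₁, u₁⟩ := h₁.swap.extract hdet.swap
    obtain ⟨z₂, δ₂, r₂, a₂, b₂, c₂, -⟩ := h₂.swap.extract hdet.swap
    have hz : z₁ = z₂ := by
      funext n
      obtain ⟨k, hk⟩ := u₁ (n + 1)
      rw [← (c₁ k).getElem n hk, ← (c₂ k).getElem n hk]
    subst hz
    exact C.oneToOne_iff.1 hone _ _ _ _ _ r₁.swap r₂.swap
      (subStream_wr_swap (b₁.trans ((subStream_wr_swap w₁).trans a₂)))
      (subStream_wr_swap (b₂.trans ((subStream_wr_swap w₂).trans a₁)))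
  have hrun := hγ'.swap.feed hy' hinf
  have hinv := Sel1.feed_inv (((C.swap).isAccRunOn_iff _ _ _).1 hγ'.swap).2.1 hy'
  have hsurj := Sel1.cfg_surjective (((C.swap).isAccRunOn_iff _ _ _).1 hγ'.swap).2.1 hy' hinf
  have hmem := mem_condSet hd hdetM.trans_finite hdetM honeM hrun.swap
  convert hmem using 1
  set j : ℕ → ℕ := fun n => (S.cfg (fun i => Tr.swap (γ' i)) y n).1 with hj
  have hratio : ratio (fun i => Tr.swap (S.feed (fun i => Tr.swap (γ' i)) y i)) = ratio γ' ∘ j := by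
    funext n
    have e1 : strm wr (fun i => Tr.swap (S.feed (fun i => Tr.swap (γ' i)) y i)) n =
        strm wr γ' (j n) := by
      rw [strm_swap]
      refine (hinv n).2.1.trans ?_
      rw [strm_swap]; rfl
    have e2 : strm rd1 (fun i => Tr.swap (S.feed (fun i => Tr.swap (γ' i)) y i)) n =
        strm rd1 γ' (j n) := by
      rw [strm_swap]
      refine (hinv n).2.2.1.trans ?_
      rw [strm_swap]; rfl
    rw [Function.comp, ratio, ratio, e1, e2]
  have hmap : Filter.map j atTop = atTop := by
    have hmono : Monotone j := Sel1.cfg_monotone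
    refine le_antisymm (tendsto_atTop_atTop.2 fun b => ?_) fun s hs => ?_
    · obtain ⟨n, hn⟩ := hsurj b
      exact ⟨n, fun i hi => hn ▸ hmono hi⟩
    · obtain ⟨N, hN⟩ := mem_atTop_sets.1 (Filter.mem_map.1 hs)
      refine mem_atTop_sets.2 ⟨j N + 1, fun b hb => ?_⟩
      obtain ⟨n, rfl⟩ := hsurj b
      exact hN n (by by_contra hc; have := hmono (not_le.1 hc).le; omega)
  rw [hratio, Filter.liminf, Filter.liminf, ← Filter.map_map, hmap]

/-! ### Block codes -/

theorem exists_fixed_code {τ : Type*} (X : Finset τ) {l : ℕ} (h : X.card ≤ 2 ^ l) :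
    ∃ f : τ → List (Fin 2), (∀ t, (f t).length = l) ∧ Set.InjOn f X := by
  classical
  have hc : Fintype.card X ≤ Fintype.card (List.Vector (Fin 2) l) := by
    rw [card_vector, Fintype.card_coe, Fintype.card_fin]; exact h
  obtain ⟨e⟩ := Function.Embedding.nonempty_of_card_le hc
  refine ⟨fun t => if h : t ∈ X then (e ⟨t, h⟩).1 else List.replicate l 0, fun t => ?_, ?_⟩
  · by_cases ht : t ∈ X
    · simp only [ht, dif_pos]; exact (e ⟨t, ht⟩).2
    · simp [ht]
  · intro t ht t' ht' he
    simp only [Finset.mem_coe] at ht ht'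
    simp only [ht, ht', dif_pos] at he
    simpa using e.injective (Subtype.ext he)

theorem exists_pair_code (E : Type*) [Fintype E] [Nonempty E] {d : ℕ} (hd : 1 ≤ d) (i j : ℕ) :
    ∃ (l : ℕ) (f : List E × List (Fin d) → List (Fin 2)), (∀ u, (f u).length = l) ∧
      (l : ℝ) * Real.log 2 ≤ Real.log 2 + (i * Real.log (Fintype.card E) + j * Real.log d) ∧
      ∀ u u' : List E × List (Fin d), u.1.length = i → u.2.length = j → u'.1.length = i →
        u'.2.length = j → f u = f u' → u = u' := by
  classical
  set X : Finset (List E × List (Fin d)) :=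
    (Finset.univ : Finset (Fin i → E)).image List.ofFn ×ˢ
      (Finset.univ : Finset (Fin j → Fin d)).image List.ofFn with hX
  have hmem : ∀ u : List E × List (Fin d), u.1.length = i → u.2.length = j → u ∈ X := by
    rintro ⟨u, v⟩ h1 h2
    simp only at h1 h2
    subst h1 h2
    simp only [hX, Finset.mem_product, Finset.mem_image, Finset.mem_univ, true_and]
    exact ⟨⟨u.get, List.ofFn_get u⟩, ⟨v.get, List.ofFn_get v⟩⟩
  set N := Fintype.card E ^ i * d ^ j with hN
  have hE : 0 < Fintype.card E := Fintype.card_pos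
  have hN0 : N ≠ 0 := by positivity
  have hcard : X.card ≤ 2 ^ (Nat.log 2 N + 1) := by
    refine le_trans ?_ (Nat.lt_pow_succ_log_self one_lt_two N).le
    rw [hX, Finset.card_product]
    refine Nat.mul_le_mul (Finset.card_image_le.trans ?_) (Finset.card_image_le.trans ?_) <;> simp
  obtain ⟨f, h1, h2⟩ := exists_fixed_code X hcard
  refine ⟨_, f, h1, ?_, fun u u' a b a' b' he => h2 (hmem u a b) (hmem u' a' b') he⟩
  have h3 : ((2 ^ Nat.log 2 N : ℕ) : ℝ) ≤ N := by exact_mod_cast Nat.pow_log_le_self 2 hN0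
  have h4 := Real.log_le_log (by positivity) h3
  rw [hN] at h4
  push_cast at h4
  rw [Real.log_mul (by positivity) (by positivity), Real.log_pow, Real.log_pow, Real.log_pow] at h4
  push_cast
  linarith

theorem length_flatMap_le {τ α : Type*} {f : τ → List α} {M : ℕ} {L : List τ}
    (h : ∀ t ∈ L, (f t).length ≤ M) : (L.flatMap f).length ≤ L.length * M := by
  induction L with
  | nil => simp
  | cons t L ih =>
    rw [List.flatMap_cons, List.length_append, List.length_cons, add_mul, one_mul, add_comm]
    exact add_le_add (ih fun t ht => h t (List.mem_cons_of_mem _ ht)) (h t List.mem_cons_self)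

theorem exists_code {E : Type*} [Fintype E] [Nonempty E] {d : ℕ} (hd : 1 ≤ d)
    {T : Set (Tr A B (Fin d) Q)} (hT : T.Finite) (g : Tr A B (Fin d) Q → List E)
    (hg : ∀ t, (g t).length ≤ 1) :
    ∃ a : ℕ, ∀ k : ℕ, ∃ enc : List (Tr A B (Fin d) Q) → List (Fin 2),
      (∀ L, enc L ≠ []) ∧
      (∀ L, ((enc L).length : ℝ) * Real.log 2 ≤ (a + 4 * k) * Real.log 2 +
        ((L.flatMap g).length * Real.log (Fintype.card E) +
          (L.flatMap wr).length * Real.log d)) ∧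
      ∀ L L' l, L.length = 2 ^ k → L'.length = 2 ^ k → (∀ t ∈ L, t ∈ T) → (∀ t ∈ L', t ∈ T) →
        enc L <+: l → enc L' <+: l → enc L = enc L' ∧
        L.getLast?.map (fun t => t.2.2.2) = L'.getLast?.map (fun t => t.2.2.2) ∧
        (L.flatMap rd1).length = (L'.flatMap rd1).length ∧
        (L.flatMap rd2).length = (L'.flatMap rd2).length ∧
        L.flatMap g = L'.flatMap g ∧ L.flatMap wr = L'.flatMap wr := by
  classical
  obtain ⟨M, hM⟩ := (hT.image fun t => (wr t).length).bddAbove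
  set b := M + 1 with hb
  have hMb : M + 1 ≤ 2 ^ b := hb ▸ Nat.lt_two_pow_self.le
  set c := hT.toFinset.card with hc
  refine ⟨c + 4 * b + 1, fun k => ?_⟩
  set key : List (Tr A B (Fin d) Q) → Option Q × ℕ × ℕ × ℕ × ℕ := fun L =>
    (L.getLast?.map (fun t => t.2.2.2), (L.flatMap rd1).length, (L.flatMap rd2).length,
      (L.flatMap g).length, (L.flatMap wr).length) with hkey
  set R := Finset.range (2 ^ (k + b)) with hR
  set X : Finset (Option Q × ℕ × ℕ × ℕ × ℕ) :=
    hT.toFinset.image (fun t => some t.2.2.2) ×ˢ (R ×ˢ (R ×ˢ (R ×ˢ R))) with hX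
  have hXcard : X.card ≤ 2 ^ (c + 4 * (k + b)) := by
    simp only [hX, hR, Finset.card_product, Finset.card_range]
    have : (hT.toFinset.image (fun t => some t.2.2.2)).card ≤ 2 ^ c :=
      Finset.card_image_le.trans Nat.lt_two_pow_self.le
    calc _ ≤ 2 ^ c * (2 ^ (k + b) * (2 ^ (k + b) * (2 ^ (k + b) * 2 ^ (k + b)))) :=
          Nat.mul_le_mul_right _ this
      _ = _ := by ring
  obtain ⟨hdr, hdr1, hdr2⟩ := exists_fixed_code X hXcard
  choose l f f1 f2 f3 using exists_pair_code E hd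
  have hlt : ∀ {n : ℕ}, n ≤ 2 ^ k * M → n < 2 ^ (k + b) := fun {n} hn => by
    rw [pow_add]
    have := Nat.mul_le_mul_left (2 ^ k) hMb
    have h2 : 0 < 2 ^ k := by positivity
    rw [mul_add] at this
    omega
  have hlt1 : ∀ {n : ℕ}, n ≤ 2 ^ k * 1 → n < 2 ^ (k + b) := fun {n} hn => by
    have : 2 ^ k < 2 ^ (k + b) := Nat.pow_lt_pow_right (by norm_num) (by omega)
    omega
  have hmem : ∀ L : List (Tr A B (Fin d) Q), L.length = 2 ^ k → (∀ t ∈ L, t ∈ T) → key L ∈ X := by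
    intro L hL hLT
    simp only [hX, hkey, hR, Finset.mem_product, Finset.mem_range]
    refine ⟨?_, hlt1 ?_, hlt1 ?_, hlt1 ?_, hlt ?_⟩
    · have hne : L ≠ [] := fun h => (pow_pos two_pos k).ne (by simpa [h] using hL)
      rw [List.getLast?_eq_getLast_of_ne_nil hne, Finset.mem_image]
      exact ⟨L.getLast hne, hT.mem_toFinset.2 (hLT _ (List.getLast_mem hne)), rfl⟩
    · exact hL ▸ length_flatMap_le fun t _ => length_rd1_le t
    · exact hL ▸ length_flatMap_le fun t _ => length_rd2_le t
    · exact hL ▸ length_flatMap_le fun t _ => hg t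
    · exact hL ▸ length_flatMap_le fun t ht => hM ⟨t, hLT t ht, rfl⟩
  refine ⟨fun L => hdr (key L) ++
    f (L.flatMap g).length (L.flatMap wr).length (L.flatMap g, L.flatMap wr), fun L => ?_,
    fun L => ?_, fun L L' w hL hL' hLT hLT' hp hp' => ?_⟩
  · refine List.ne_nil_of_length_pos ?_
    rw [List.length_append, hdr1]
    omega
  · rw [List.length_append, hdr1, f1]
    have := f2 (L.flatMap g).length (L.flatMap wr).length
    push_cast
    linarith
  · have e1 : hdr (key L) = hdr (key L') :=
      (List.prefix_of_prefix_length_le ((List.prefix_append _ _).trans hp)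
        ((List.prefix_append _ _).trans hp') (by rw [hdr1, hdr1])).eq_of_length (by rw [hdr1, hdr1])
    have e2 := hdr2 (hmem L hL hLT) (hmem L' hL' hLT') e1
    have e3 := e2
    simp only [hkey, Prod.mk.injEq] at e3
    obtain ⟨k1, k2, k3, k4, k5⟩ := e3
    simp only [← e1, ← k4, ← k5] at hp hp'
    have e4 := (List.prefix_of_prefix_length_le hp hp'
      (by simp [f1])).eq_of_length (by simp [f1])
    have e5 := f3 _ _ (L.flatMap g, L.flatMap wr) (L'.flatMap g, L'.flatMap wr) rfl rfl k4.symm k5.symm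
      (List.append_cancel_left e4)
    simp only [Prod.mk.injEq] at e5
    exact ⟨by simp only [e2, e5.1, e5.2], k1, k2, k3, e5.1, e5.2⟩

/-! ### Recoding the output of a transducer block by block -/

section Recode

variable {E F : Type*}

/-- The transition taken by the recoding transducer when `τ` is taken with the transitions of the
current block stored in `buf`. -/
def recTr (K : ℕ) (enc : List (Tr A B D Q) → List E) (τ : Tr A B D Q) (buf : List (Tr A B D Q)) :
    Tr A B E (Q × List (Tr A B D Q)) :=
  ((τ.1, buf), τ.2.1, if buf.length + 1 = K then enc (buf ++ [τ]) else [],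
    (τ.2.2.2, if buf.length + 1 = K then [] else buf ++ [τ]))

/-- The transducer that uses the transitions in `T` and writes the code of each block of `K`
successive transitions. -/
def recode (K : ℕ) (enc : List (Tr A B D Q) → List E) (T : Set (Tr A B D Q)) (p : Q) :
    Comp3 A B E (Q × List (Tr A B D Q)) where
  init := (p, [])
  trans := {t | ∃ τ ∈ T, ∃ buf : List (Tr A B D Q), buf.length < K ∧ (∀ u ∈ buf, u ∈ T) ∧
    t = recTr K enc τ buf}

/-- The `i`-th block of `K` transitions. -/
def blockAt (K : ℕ) (τ : ℕ → Tr A B D Q) (i : ℕ) : List (Tr A B D Q) :=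
  pref (fun k => τ (i * K + k)) K

/-- The content of the buffer after `n` transitions. -/
def bufAt (K : ℕ) (τ : ℕ → Tr A B D Q) (n : ℕ) : List (Tr A B D Q) :=
  pref (fun k => τ (n / K * K + k)) (n % K)

variable {K : ℕ} {enc : List (Tr A B D Q) → List E} {T : Set (Tr A B D Q)} {p : Q}

theorem finite_lists_of_finite {τ : Type*} {T : Set τ} (hT : T.Finite) (K : ℕ) :
    {l : List τ | l.length < K ∧ ∀ u ∈ l, u ∈ T}.Finite := by
  have := hT.to_subtype
  refine ((List.finite_length_lt T K).image (List.map Subtype.val)).subset ?_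
  rintro l ⟨hl, hm⟩
  lift l to List T using hm
  exact ⟨l, by simpa using hl, rfl⟩

theorem recode_finite (hT : T.Finite) : (recode K enc T p).trans.Finite := by
  refine (Set.Finite.image2 (recTr K enc) hT (finite_lists_of_finite hT K)).subset ?_
  rintro t ⟨τ, hτ, buf, h1, h2, rfl⟩
  exact ⟨τ, hτ, buf, ⟨h1, h2⟩, rfl⟩

theorem Comp3.TwoDet.recode {C : Comp3 A B D Q} (h : C.TwoDet) (hT : T ⊆ C.trans) :
    (recode K enc T p).TwoDet := by
  rintro t ⟨τ, hτ, buf, -, -, rfl⟩ t' ⟨τ', hτ', buf', -, -, rfl⟩ he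
  simp only [recTr, Prod.mk.injEq] at he
  obtain ⟨h1, h2⟩ := h τ (hT hτ) τ' (hT hτ') he.1
  refine ⟨h1, fun hl => ?_⟩
  rw [h2 hl, he.2]

theorem bufAt_succ (hK : 0 < K) (τ : ℕ → Tr A B D Q) (n : ℕ) :
    bufAt K τ (n + 1) = if (bufAt K τ n).length + 1 = K then [] else bufAt K τ n ++ [τ n] := by
  have h1 : (bufAt K τ n).length = n % K := by rw [bufAt, pref_length]
  have h2 := Nat.div_add_mod' n K
  rw [h1]
  split_ifs with h
  · rw [bufAt, show (n + 1) % K = 0 by rw [← h2, add_assoc, h]; simp, pref_zero]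
  · have hlt := Nat.mod_lt n hK
    have h3 : (n + 1) % K = n % K + 1 := by
      rw [← h2, add_assoc, Nat.mul_add_mod_self_right, Nat.mul_add_mod_self_right, Nat.mod_mod]
      exact Nat.mod_eq_of_lt (by omega)
    have h4 : (n + 1) / K = n / K := by
      have := Nat.div_add_mod' (n + 1) K
      rw [h3] at this
      exact Nat.eq_of_mul_eq_mul_right hK (by omega)
    rw [bufAt, bufAt, h3, h4, pref_succ, h2]

theorem IsRun.recode (hK : 0 < K) {τ : ℕ → Tr A B D Q} (h : IsRun T p τ) :
    IsRun (recode K enc T p).trans (recode K enc T p).init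
      fun n => recTr K enc (τ n) (bufAt K τ n) := by
  refine ⟨?_, fun n => ⟨τ n, h.mem n, bufAt K τ n, ?_, fun u hu => ?_, rfl⟩, fun n => ?_⟩
  · simp [recTr, FSI.recode, bufAt, pref_zero, h.start]
  · rw [bufAt, pref_length]; exact Nat.mod_lt n hK
  · simp only [bufAt, pref, List.mem_map, List.mem_range] at hu
    obtain ⟨i, -, rfl⟩ := hu
    exact h.mem _
  · simp only [recTr, h.chain, bufAt_succ hK]

theorem IsRun.of_recode (hK : 0 < K) {γ : ℕ → Tr A B E (Q × List (Tr A B D Q))}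
    (h : IsRun (FSI.recode K enc T p).trans (FSI.recode K enc T p).init γ) :
    ∃ τ, IsRun T p τ ∧ γ = fun n => recTr K enc (τ n) (bufAt K τ n) := by
  choose τ hτ buf hb hbT he using h.mem
  have hbuf : ∀ n, buf n = bufAt K τ n := by
    intro n
    induction n with
    | zero =>
      have := h.start
      rw [he 0] at this
      simp only [recTr, FSI.recode, Prod.mk.injEq] at this
      rw [this.2, bufAt, Nat.zero_mod, pref_zero]
    | succ n ih =>
      have := h.chain n
      rw [he n, he (n + 1)] at this
      simp only [recTr, Prod.mk.injEq] at this
      rw [bufAt_succ hK, ← ih, this.2]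
  refine ⟨τ, ⟨?_, hτ, fun n => ?_⟩, funext fun n => by rw [he n, hbuf n]⟩
  · have := h.start
    rw [he 0] at this
    simp only [recTr, FSI.recode, Prod.mk.injEq] at this
    exact this.1
  · have := h.chain n
    rw [he n, he (n + 1)] at this
    simp only [recTr, Prod.mk.injEq] at this
    exact this.1

theorem strm_wr_recode (hK : 0 < K) (τ : ℕ → Tr A B D Q) (n : ℕ) :
    strm wr (fun n => recTr K enc (τ n) (bufAt K τ n)) n = strm enc (blockAt K τ) (n / K) := by
  induction n with
  | zero => rw [Nat.zero_div]; rfl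
  | succ n ih =>
    have h1 : (bufAt K τ n).length = n % K := by rw [bufAt, pref_length]
    have h2 := Nat.div_add_mod' n K
    rw [strm_succ, ih]
    simp only [wr, recTr, h1]
    split_ifs with h
    · have h3 : n + 1 = (n / K + 1) * K := by rw [add_mul, one_mul]; omega
      rw [h3, Nat.mul_div_cancel _ hK, strm_succ]
      congr 2
      rw [bufAt, blockAt]
      have h4 : pref (fun k => τ (n / K * K + k)) K = pref (fun k => τ (n / K * K + k)) (n % K + 1) := by
        rw [h]
      rw [h4, pref_succ, h2]
    · have hlt := Nat.mod_lt n hK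
      have h4 : (n + 1) / K = n / K := by
        refine Nat.div_eq_of_lt_le (by omega) ?_
        rw [add_mul, one_mul]; omega
      rw [h4, List.append_nil]

end Recode

theorem strm_succ_mul {F : Type*} {K : ℕ} (f : Tr A B D Q → List F) (τ : ℕ → Tr A B D Q) (q : ℕ) :
    strm f τ ((q + 1) * K) = strm f τ (q * K) ++ (blockAt K τ q).flatMap f := by
  rw [add_mul, one_mul, strm_add]; rfl

theorem recode_oneToOne {F E : Type*} {C : Comp3 A B D Q} {g : Tr A B D Q → List F}
    (hC : C.InjWith g) {γ : ℕ → Tr A B D Q} {x : ℕ → A} {y : ℕ → B} (hγ : C.IsAccRunOn γ x y)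
    {K : ℕ} (hK : 0 < K) {enc : List (Tr A B D Q) → List E}
    (henc : ∀ L L' l, L.length = K → L'.length = K → (∀ t ∈ L, t ∈ Set.range γ) →
      (∀ t ∈ L', t ∈ Set.range γ) → enc L <+: l → enc L' <+: l → enc L = enc L' ∧
        L.getLast?.map (fun t => t.2.2.2) = L'.getLast?.map (fun t => t.2.2.2) ∧
        (L.flatMap rd1).length = (L'.flatMap rd1).length ∧
        (L.flatMap rd2).length = (L'.flatMap rd2).length ∧
        L.flatMap g = L'.flatMap g ∧ L.flatMap wr = L'.flatMap wr) :
    (recode K enc (Set.range γ) C.init).OneToOne := by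
  have hT : Set.range γ ⊆ C.trans := by
    rintro _ ⟨n, rfl⟩
    exact (((C.isAccRunOn_iff _ _ _).1 hγ).1).mem n
  rw [Comp3.oneToOne_iff]
  intro x₁ x₂ z γ₁ γ₂ h₁ h₂ w₁ w₂
  rw [Comp3.isAccRunOn_iff] at h₁ h₂
  obtain ⟨r₁, a₁, b₁, -⟩ := h₁
  obtain ⟨r₂, a₂, b₂, -⟩ := h₂
  obtain ⟨τ₁, t₁, rfl⟩ := r₁.of_recode hK
  obtain ⟨τ₂, t₂, rfl⟩ := r₂.of_recode hK
  replace a₁ : Spells rd1 τ₁ x₁ := a₁.congr (by intro n; rfl)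
  replace a₂ : Spells rd1 τ₂ x₂ := a₂.congr (by intro n; rfl)
  replace b₁ : Spells rd2 τ₁ z := b₁.congr (by intro n; rfl)
  replace b₂ : Spells rd2 τ₂ z := b₂.congr (by intro n; rfl)
  have hout : ∀ q, ∃ l, strm enc (blockAt K τ₁) q <+: l ∧ strm enc (blockAt K τ₂) q <+: l := by
    intro q
    obtain ⟨m, hm⟩ := w₁ (q * K)
    rw [strm_wr_recode hK, Nat.mul_div_cancel _ hK] at hm
    refine ⟨_, hm.trans (strm_mono _ _ (le_max_left m (q * K))), ?_⟩
    have := strm_mono wr (fun n => recTr K enc (τ₂ n) (bufAt K τ₂ n)) (le_max_right m (q * K))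
    rwa [strm_wr_recode hK τ₂ (q * K), Nat.mul_div_cancel _ hK] at this
  have hpath : ∀ {τ : ℕ → Tr A B D Q}, IsRun (Set.range γ) C.init τ → ∀ q,
      Path (Set.range γ) (τ (q * K)).1 (blockAt K τ q) (τ ((q + 1) * K)).1 := by
    intro τ h q
    have := (h.tail (q * K)).path K
    rwa [show q * K + K = (q + 1) * K by rw [add_mul, one_mul]] at this
  have hlen : ∀ (τ : ℕ → Tr A B D Q) q, (blockAt K τ q).length = K := fun τ q => by
    rw [blockAt, pref_length]
  have hmemT : ∀ {τ : ℕ → Tr A B D Q}, IsRun (Set.range γ) C.init τ → ∀ q,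
      ∀ t ∈ blockAt K τ q, t ∈ Set.range γ := by
    intro τ h q t ht
    simp only [blockAt, pref, List.mem_map, List.mem_range] at ht
    obtain ⟨i, -, rfl⟩ := ht
    exact h.mem _
  have hne : ∀ (τ : ℕ → Tr A B D Q) q, blockAt K τ q ≠ [] := fun τ q h => by
    have := hlen τ q
    rw [h, List.length_nil] at this
    omega
  have hmain : ∀ q, (τ₁ (q * K)).1 = (τ₂ (q * K)).1 ∧
      strm rd1 τ₁ (q * K) = strm rd1 τ₂ (q * K) ∧ strm rd2 τ₁ (q * K) = strm rd2 τ₂ (q * K) ∧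
      strm enc (blockAt K τ₁) q = strm enc (blockAt K τ₂) q := by
    intro q
    induction q with
    | zero => rw [zero_mul, t₁.start, t₂.start]; exact ⟨rfl, rfl, rfl, rfl⟩
    | succ q ih =>
      obtain ⟨i1, i2, i3, i4⟩ := ih
      obtain ⟨l, hl₁, hl₂⟩ := hout (q + 1)
      rw [strm_succ] at hl₁ hl₂
      obtain ⟨l', rfl⟩ := (List.prefix_append _ _).trans hl₁
      rw [List.prefix_append_right_inj] at hl₁
      rw [i4, List.prefix_append_right_inj] at hl₂
      obtain ⟨k0, k1, k2, k3, k4, k5⟩ := henc _ _ l' (hlen τ₁ q) (hlen τ₂ q) (hmemT t₁ q)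
        (hmemT t₂ q) hl₁ hl₂
      have p₁ := hpath t₁ q
      have p₂ := hpath t₂ q
      rw [p₁.getLast? (hne _ _), p₂.getLast? (hne _ _), Option.some_inj] at k1
      have hrd2 : strm rd2 τ₁ ((q + 1) * K) = strm rd2 τ₂ ((q + 1) * K) := by
        rw [b₁.1 ((q + 1) * K), b₂.1 ((q + 1) * K), strm_succ_mul, strm_succ_mul, List.length_append,
          List.length_append, k3, i3]
      have e2 : (blockAt K τ₁ q).flatMap rd2 = (blockAt K τ₂ q).flatMap rd2 := by
        rw [strm_succ_mul, strm_succ_mul, i3] at hrd2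
        exact List.append_cancel_left hrd2
      obtain ⟨i, hi⟩ := t₁.mem (q * K)
      obtain ⟨j, hj⟩ := t₁.mem ((q + 1) * K)
      rw [← i1, ← k1] at p₂
      rw [← hi, ← hj] at p₁ p₂
      have e1 := hC.eq_of_path hγ (p₁.mono hT) (p₂.mono hT) (fun l f => by rw [e2]) k5 k4 k2
      refine ⟨k1, ?_, hrd2, ?_⟩
      · rw [strm_succ_mul, strm_succ_mul, i2, e1]
      · rw [strm_succ, strm_succ, i4, k0]
  funext n
  obtain ⟨m, hm⟩ := a₁.2 (n + 1)
  have h1 := strm_length_mono rd1 τ₁ (Nat.le_mul_of_pos_right m hK)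
  simp only at h1
  refine pref_inj ((a₁.1 (m * K)).symm.trans ?_) (show n < _ by omega)
  rw [(hmain m).2.1]
  exact a₂.1 (m * K)

theorem length_code_le {E : Type*} [Fintype E] {d : ℕ} {enc : List (Tr A B (Fin d) Q) → List (Fin 2)}
    {g : Tr A B (Fin d) Q → List E} {r : ℝ} (h : ∀ L, ((enc L).length : ℝ) * Real.log 2 ≤
      r + ((L.flatMap g).length * Real.log (Fintype.card E) + (L.flatMap wr).length * Real.log d))
    (K : ℕ) (γ : ℕ → Tr A B (Fin d) Q) (q : ℕ) :
    ((strm enc (blockAt K γ) q).length : ℝ) * Real.log 2 ≤ q * r +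
      ((strm g γ (q * K)).length * Real.log (Fintype.card E) +
        (strm wr γ (q * K)).length * Real.log d) := by
  induction q with
  | zero => simp [strm_zero]
  | succ q ih =>
    have := h (blockAt K γ q)
    rw [strm_succ_mul, strm_succ_mul, strm_succ]
    simp only [List.length_append]
    push_cast
    linarith

theorem exists_recode {E : Type*} [Fintype A] [Fintype B] [Finite Q] [Fintype E] [Nonempty E] {d : ℕ}
    (hd : 1 ≤ d) {C : Comp3 A B (Fin d) Q} (hdet : C.TwoDet) {g : Tr A B (Fin d) Q → List E}
    (hg : ∀ t, (g t).length ≤ 1) (hC : C.InjWith g) {γ : ℕ → Tr A B (Fin d) Q} {x : ℕ → A}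
    {y : ℕ → B} (hγ : C.IsAccRunOn γ x y) :
    ∃ a : ℕ, ∀ k : ℕ, ∃ u : ℕ → ℕ,
      Filter.liminf (fun n => ((u n : ℝ) * Real.log 2) /
        (((strm rd1 γ n).length : ℝ) * Real.log (Fintype.card A))) atTop ∈ condSet x y ∧
      ∀ n, (u n : ℝ) * Real.log 2 ≤ n * (((a + 4 * k) / 2 ^ k) * Real.log 2) +
        ((strm g γ n).length * Real.log (Fintype.card E) +
          (strm wr γ n).length * Real.log d) := by
  have hacc := (C.isAccRunOn_iff _ _ _).1 hγ
  have hT : Set.range γ ⊆ C.trans := by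
    rintro _ ⟨n, rfl⟩
    exact hacc.1.mem n
  have hTfin := hdet.trans_finite.subset hT
  obtain ⟨a, ha⟩ := exists_code hd hTfin g hg
  refine ⟨a, fun k => ?_⟩
  obtain ⟨enc, hne, hlen, hinj⟩ := ha k
  set K := 2 ^ k with hK
  have hK0 : 0 < K := by positivity
  set γ' : ℕ → Tr A B (Fin 2) (Q × List (Tr A B (Fin d) Q)) :=
    fun n => recTr K enc (γ n) (bufAt K γ n) with hγ'
  have hone := recode_oneToOne hC hγ hK0 hinj
  have hrun : IsRun (Set.range γ) C.init γ := ⟨hacc.1.start, fun n => ⟨n, rfl⟩, hacc.1.chain⟩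
  have hout : ∀ n, strm wr γ' n = strm enc (blockAt K γ) (n / K) := strm_wr_recode hK0 γ
  have hrun' : (recode K enc (Set.range γ) C.init).IsAccRunOn γ' x y := by
    rw [Comp3.isAccRunOn_iff]
    refine ⟨hrun.recode hK0, hacc.2.1.congr (by intro n; rfl), hacc.2.2.1.congr (by intro n; rfl),
      fun N => ⟨N * K, ?_⟩⟩
    rw [hout, Nat.mul_div_cancel _ hK0]
    induction N with
    | zero => exact Nat.zero_le _
    | succ N ih =>
      have := List.length_pos_iff.2 (hne (blockAt K γ N))
      rw [strm_succ, List.length_append]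
      omega
  refine ⟨fun n => (strm wr γ' n).length, ?_, fun n => ?_⟩
  · convert mem_condSet le_rfl (recode_finite hTfin) (hdet.recode hT) hone hrun' using 2
    funext n
    rw [ratio, strm_congr (f := rd1) (g := rd1) (γ := γ') (δ := γ) (by intro n; rfl)]
    norm_num
  · have h1 := length_code_le hlen K γ (n / K)
    rw [← hout] at h1
    have h2 : n / K * K ≤ n := Nat.div_mul_le_self n K
    have h3 : ((strm g γ (n / K * K)).length : ℝ) ≤ (strm g γ n).length := by
      exact_mod_cast strm_length_mono g γ h2
    have h4 : ((strm wr γ (n / K * K)).length : ℝ) ≤ (strm wr γ n).length := by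
      exact_mod_cast strm_length_mono wr γ h2
    have h5 : ((n / K : ℕ) : ℝ) ≤ n / 2 ^ k := by
      have := @Nat.cast_div_le ℝ _ _ _ n K
      rwa [hK, Nat.cast_pow, Nat.cast_ofNat, ← hK] at this
    have h6 := Real.log_natCast_nonneg d
    have h7 := Real.log_natCast_nonneg (Fintype.card E)
    have h8 : 0 ≤ ((a : ℝ) + 4 * k) * Real.log 2 := by
      have := Real.log_nonneg (show (1 : ℝ) ≤ 2 by norm_num)
      positivity
    have h9 := mul_le_mul_of_nonneg_right h5 h8
    have h10 := mul_le_mul_of_nonneg_right h3 h7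
    have h11 := mul_le_mul_of_nonneg_right h4 h6
    have h12 : (n : ℝ) / 2 ^ k * ((a + 4 * k) * Real.log 2) =
      n * (((a + 4 * k) / 2 ^ k) * Real.log 2) := by ring
    linarith

theorem Sel1.exists_le_mul_length_outList [Fintype B] (S : Sel1 B) {y : ℕ → B} (hy : Normal y)
    (hinf : ∀ N, ∃ n, N ≤ (S.outList y n).length) :
    ∃ c : ℕ, ∀ n, n ≤ c * ((S.outList y n).length + 1) := by
  let T : Fin S.states → B → Tr Unit B Unit (Fin S.states) := fun q b =>
    (q, (if S.sel q then some () else none, some b), [], S.δ q b)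
  let C : Comp3 Unit B Unit (Fin S.states) := ⟨S.init, {t | ∃ q b, t = T q b}⟩
  let γ : ℕ → Tr Unit B Unit (Fin S.states) := fun n => T (S.st y n) (y n)
  have hdet : C.TwoDet := by
    rintro t ⟨q, b, rfl⟩ t' ⟨q', b', rfl⟩ he
    obtain rfl : q = q' := he
    refine ⟨rfl, fun hl => ?_⟩
    simp only [T, Prod.mk.injEq, Option.some_inj] at hl
    rw [hl.2]
  have hrun : IsRun C.trans C.init γ := ⟨rfl, fun n => ⟨_, _, rfl⟩, fun n => rfl⟩
  have h1 : ∀ n, (strm rd1 γ n).length = (S.outList y n).length := by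
    intro n
    induction n with
    | zero => rfl
    | succ n ih =>
      rw [strm_succ, S.outList_succ, List.length_append, List.length_append, ih]
      by_cases hs : S.sel (S.st y n) <;> simp [γ, T, rd1, hs]
  have h2 : ∀ n, strm rd2 γ n = pref y n := by
    intro n
    induction n with
    | zero => rfl
    | succ n ih => rw [strm_succ, pref_succ, ih]; rfl
  have hsp : Spells rd2 γ y := ⟨fun n => by rw [h2]; exact begins_pref y n,
    fun N => ⟨N, by rw [h2, pref_length]⟩⟩
  obtain ⟨c, hc⟩ := exists_le_mul_length_rd1 hdet hrun hsp
    (fun N => by obtain ⟨n, hn⟩ := hinf N; exact ⟨n, by rwa [h1]⟩) hy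
  exact ⟨c, fun n => by rw [← h1]; exact hc n⟩

theorem Sel1.length_skipList_add (S : Sel1 B) (y : ℕ → B) (n : ℕ) :
    (S.skipList y n).length + (S.outList y n).length = n := by
  induction n with
  | zero => rfl
  | succ n ih =>
    rw [S.skipList_succ, S.outList_succ, List.length_append, List.length_append]
    by_cases hs : S.sel (S.st y n) <;> simp [hs] <;> omega

/-! ### Selection from the compressed word -/

theorem selection_estimate {I s n u c E W β ρ K : ℝ} (hβ : 0 < β) (hρ : ρ < 1) (hK : 1 ≤ K)
    (hE : 0 ≤ E) (hcE : c * E * (8 * K) ≤ (1 - ρ) * β) (hn : n ≤ c * (I + 1))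
    (hs : I ≤ K * (s + 1)) (hW : W ≤ ρ * (s * β)) (hI : 8 * K ≤ I)
    (hu : u ≤ n * E + ((I - s) * β + W)) : u ≤ (1 - (1 - ρ) / (2 * K)) * (I * β) := by
  set q := (1 - ρ) * β / K with hq
  have hK0 : 0 < K := by linarith
  have hq0 : 0 < q := by have : 0 < 1 - ρ := by linarith
                         positivity
  have hqK : q * K = (1 - ρ) * β := by rw [hq]; field_simp
  have h1 : n * E ≤ c * E * (I + 1) := by nlinarith
  have h2 : c * E ≤ q / 8 := by
    rw [← hqK] at hcE
    have : c * E * 8 * K ≤ q * K := by linarith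
    have := le_of_mul_le_mul_right this hK0
    linarith
  have h3 : q * I ≤ (1 - ρ) * β * (s + 1) := by rw [← hqK]; nlinarith
  have h4 : c * E * (I + 1) ≤ q / 8 * (I + 1) := mul_le_mul_of_nonneg_right h2 (by linarith)
  have h5 : q * (8 * K) ≤ q * I := mul_le_mul_of_nonneg_left hI hq0.le
  have h6 : q * 8 ≤ q * I := by nlinarith
  have h7 : (1 - (1 - ρ) / (2 * K)) * (I * β) = I * β - q * I / 2 := by
    rw [hq]; field_simp
  rw [h7]
  nlinarith

theorem tendsto_add_mul_div_two_pow (a : ℝ) :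
    Tendsto (fun k : ℕ => (a + 4 * k) / 2 ^ k) atTop (𝓝 0) := by
  have h1 : Tendsto (fun k : ℕ => a * (1 / 2 : ℝ) ^ k) atTop (𝓝 (a * 0)) :=
    (tendsto_pow_atTop_nhds_zero_of_lt_one (by norm_num) (by norm_num)).const_mul a
  have h2 : Tendsto (fun k : ℕ => 4 * ((k : ℝ) * (1 / 2 : ℝ) ^ k)) atTop (𝓝 (4 * 0)) :=
    (tendsto_self_mul_const_pow_of_lt_one (by norm_num) (by norm_num)).const_mul 4
  have h3 := h1.add h2
  rw [mul_zero, mul_zero, add_zero] at h3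
  refine h3.congr fun k => ?_
  rw [one_div, inv_pow]
  ring

theorem one_le_condRho_of_selection [Fintype A] [Fintype B] {x : ℕ → A} {y y' : ℕ → B}
    {S : Sel1 B} (hB : 2 ≤ Fintype.card B) (hx : Normal x) (hy : Normal y)
    (hy' : ∀ n, Begins (S.outList y n) y') (hinf : ∀ N, ∃ n, N ≤ (S.outList y n).length)
    (hyx : 1 ≤ condRho y x) : 1 ≤ condRho y' x := by
  rw [condRho_eq]
  refine le_csInf ⟨1, ratioSet_subset_condSet _ _ (one_mem_ratioSet hB y')⟩ ?_
  rintro r ⟨m, d, hd, C, hdet, hone, γ', hγ', rfl⟩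
  by_contra! hlt
  obtain ⟨ρ, hρ1, hρ⟩ := exists_between hlt
  have : Nonempty B := Fintype.card_pos_iff.1 (by omega)
  have hβ : 0 < Real.log (Fintype.card B) := Real.log_pos (by exact_mod_cast hB)
  have hl2 : 0 < Real.log 2 := Real.log_pos (by norm_num)
  set γ := S.feed γ' y with hγdef
  have hγ : (selComp S C).IsAccRunOn γ y x := hγ'.feed hy' hinf
  have hdetS : (selComp S C).TwoDet := hdet.selComp
  have hγ2 := ((selComp S C).isAccRunOn_iff _ _ _).1 hγ
  have hγ2' := (C.isAccRunOn_iff _ _ _).1 hγ'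
  obtain ⟨c, hc⟩ := exists_le_mul_length_rd1 hdetS hγ2.1 hγ2.2.2.1 hγ2.2.1.2 hx
  obtain ⟨cS, hcS⟩ := S.exists_le_mul_length_outList hy hinf
  have hskp : ∀ t : Tr B A (Fin d) (Fin m × Fin S.states), (S.skp t).length ≤ 1 := by
    intro t
    unfold Sel1.skp rd1
    split_ifs
    · cases t.2.1.1 <;> simp
    · simp
  obtain ⟨a, ha⟩ := exists_recode (by omega) hdetS hskp
    (Comp3.OneToOne.selComp_injWith hdet hone) hγ
  have hK : (1 : ℝ) ≤ cS + 1 := by have := Nat.cast_nonneg (α := ℝ) cS; linarith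
  obtain ⟨k, hk⟩ : ∃ k : ℕ, (c : ℝ) * (((a + 4 * k) / 2 ^ k) * Real.log 2) * (8 * (cS + 1)) ≤
      (1 - ρ) * Real.log (Fintype.card B) := by
    have h1 := ((((tendsto_add_mul_div_two_pow a).mul_const (Real.log 2)).const_mul
      (c : ℝ)).mul_const (8 * ((cS : ℝ) + 1)))
    rw [zero_mul, mul_zero, zero_mul] at h1
    exact (h1.eventually_le_const (mul_pos (sub_pos.2 hρ) hβ)).exists
  obtain ⟨u, hmem, hu⟩ := ha k
  have hinv := Sel1.feed_inv hγ2'.2.1 hy'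
  have hfreq : ∃ᶠ n in atTop, ratio γ' (S.cfg γ' y n).1 < ρ := by
    obtain ⟨M, hM⟩ := exists_ratio_le hdet hγ' hx
    have h1 := frequently_lt_of_liminf_lt
      (isBoundedUnder_of ⟨M, hM⟩ : IsBoundedUnder (· ≤ ·) atTop (ratio γ')).isCoboundedUnder_ge hρ1
    have hmono : Monotone fun n => (S.cfg γ' y n).1 := Sel1.cfg_monotone
    have hsurj := Sel1.cfg_surjective hγ2'.2.1 hy' hinf
    rw [frequently_atTop] at h1 ⊢
    intro N
    obtain ⟨b, hb, hb'⟩ := h1 ((S.cfg γ' y N).1 + 1)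
    obtain ⟨n, rfl⟩ := hsurj b
    exact ⟨n, by by_contra hcon; have := hmono (not_le.1 hcon).le; simp only at this hb; omega, hb'⟩
  have hI : ∀ᶠ n in atTop, 8 * ((cS : ℝ) + 1) ≤ (strm rd1 γ n).length :=
    (tendsto_natCast_atTop_atTop.comp ((unb_iff _ _).1 hγ2.2.1.2)).eventually_ge_atTop _
  have hle : liminf (fun n => ((u n : ℝ) * Real.log 2) /
      (((strm rd1 γ n).length : ℝ) * Real.log (Fintype.card B))) atTop ≤
        1 - (1 - ρ) / (2 * ((cS : ℝ) + 1)) := by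
    refine liminf_le_of_frequently_le ((hfreq.and_eventually hI).mono ?_)
      (isBoundedUnder_of ⟨0, fun n => by have := hl2.le; have := hβ.le; positivity⟩)
    rintro n ⟨h1, h2⟩
    have hIpos : (0 : ℝ) < (strm rd1 γ n).length := by linarith
    rw [div_le_iff₀ (mul_pos hIpos hβ)]
    have hlen : (strm rd1 γ n).length = (S.cfg γ' y n).2 := by rw [(hinv n).1, pref_length]
    have hs := (hinv n).2.2.2.1
    have hskl := S.length_skipList_add y (strm rd1 γ n).length
    have hIs := hcS (strm rd1 γ n).length
    rw [hlen, hs] at hskl hIs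
    rw [← hlen] at hskl hIs
    have hun := hu n
    rw [strm_skp hγ, (hinv n).2.1] at hun
    have hspos : 0 < (strm rd1 γ' (S.cfg γ' y n).1).length := by
      by_contra h0
      have h3 : (strm rd1 γ' (S.cfg γ' y n).1).length = 0 := by omega
      rw [h3] at hIs
      have : ((strm rd1 γ n).length : ℝ) ≤ cS * (0 + 1) := by exact_mod_cast hIs
      linarith
    rw [ratio, div_lt_iff₀ (mul_pos (by exact_mod_cast hspos) hβ)] at h1
    refine selection_estimate hβ hρ hK (by positivity) hk (n := n) ?_
      (s := (strm rd1 γ' (S.cfg γ' y n).1).length) ?_ h1.le h2 ?_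
    · exact_mod_cast hc n
    · have h3 : ((strm rd1 γ n).length : ℝ) ≤
          cS * ((strm rd1 γ' (S.cfg γ' y n).1).length + 1) := by exact_mod_cast hIs
      refine h3.trans (mul_le_mul_of_nonneg_right (by linarith) (by positivity))
    · refine hun.trans_eq ?_
      have h3 : ((S.skipList y (strm rd1 γ n).length).length : ℝ) =
          (strm rd1 γ n).length - (strm rd1 γ' (S.cfg γ' y n).1).length :=
        eq_sub_of_add_eq (by exact_mod_cast hskl)
      rw [h3]
  have hge := csInf_le (condSet_bddBelow y x) hmem
  rw [← condRho_eq] at hge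
  have : 0 < (1 - ρ) / (2 * ((cS : ℝ) + 1)) := div_pos (sub_pos.2 hρ) (by linarith)
  linarith

/-- If `x` and `y` are normal and finite-state independent and `y'`
is obtained from `y` by oblivious selection by a finite automaton (with infinite
output), then `x` and `y'` are finite-state independent. -/
theorem fsIndep_of_oblivious_selection {A B : Type*} [Fintype A] [Fintype B]
    (x : ℕ → A) (y : ℕ → B) (hx : Normal x) (hy : Normal y) (hind : FSIndep x y)
    (S : Sel1 B) (y' : ℕ → B)
    (hinf : Tendsto (fun n => (S.outList y n).length) atTop atTop)
    (hy' : ∀ n, S.outList y n = pref y' (S.outList y n).length) :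
    FSIndep x y' := by
  obtain ⟨hxy, hyx, hx0, hy0⟩ := hind
  have hA := two_le_card_of_rho_pos hx0
  have hB := two_le_card_of_rho_pos hy0
  have hinf' : ∀ N, ∃ n, N ≤ (S.outList y n).length := fun N => (hinf.eventually_ge_atTop N).exists
  have h1 : 1 ≤ condRho y' x :=
    one_le_condRho_of_selection hB hx hy hy' hinf' (hyx ▸ hy.one_le_rho hB)
  have h2 : condRho y' x ≤ rho y' := condRho_le_rho y' x ⟨1, one_mem_ratioSet hB y'⟩
  have h3 : rho y' ≤ 1 := by
    rw [rho_eq]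
    exact csInf_le ((condSet_bddBelow y' x).mono (ratioSet_subset_condSet y' x))
      (one_mem_ratioSet hB y')
  have h4 : rho x ≤ condRho x y' := by
    rw [← hxy, condRho_eq, condRho_eq]
    exact csInf_le_csInf (condSet_bddBelow x y)
      ⟨1, ratioSet_subset_condSet _ _ (one_mem_ratioSet hA x)⟩
      (condSet_subset_of_selection hy' hinf')
  exact ⟨le_antisymm (condRho_le_rho x y' ⟨1, one_mem_ratioSet hA x⟩) h4, by linarith, hx0,
    by linarith⟩

end FSI
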